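/- arXiv:math/0507514 — 3 statements merged into one kernel-verified Lean document; each statement's English description precedes it below -/
import Mathlib

section
/- The number of basic triangle trees on a totally ordered set of 2n+1 vertices has exponential generating function arcsin(u): that is, Σ_{n≥0} b_{2n+1} u^{2n+1}/(2n+1)! = arcsin(u), where b_{2n+1} is the number of basic triangle trees on {1,...,2n+1}. -/
section TriangleGraphs

variable {α : Type*} [DecidableEq α]

/-- A triangle graph on the vertex set `V`: each edge is a 3-element subset of `V`. -/
def IsTriangleGraph (V : Finset α) (E : Finset (Finset α)) : Prop :=
  ∀ e ∈ E, e.card = 3 ∧ e ⊆ V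

/-- The edge set `E` contains a cycle: a path of length `> 1` from a vertex to itself
consisting of distinct edges and distinct vertices. -/
def HasTriCycle (E : Finset (Finset α)) : Prop :=
  ∃ (n : ℕ) (e : ℕ → Finset α) (v : ℕ → α),
    1 < n ∧
    (∀ i, 1 ≤ i → i ≤ n → e i ∈ E) ∧
    (∀ i j, 1 ≤ i → i < j → j ≤ n → e i ≠ e j) ∧
    (∀ i j, i < j → j < n → v i ≠ v j) ∧
    v n = v 0 ∧ v 0 ∈ e 1 ∧ v n ∈ e n ∧
    (∀ i, 0 < i → i < n → v i ∈ e i ∧ v i ∈ e (i + 1))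

/-- Two vertices lie on a common edge. -/
def TriStep (E : Finset (Finset α)) (x y : α) : Prop := ∃ e ∈ E, x ∈ e ∧ y ∈ e

/-- Reachability (connectivity) in a triangle graph. -/
def TriReach (E : Finset (Finset α)) : α → α → Prop := Relation.ReflTransGen (TriStep E)

/-- A triangle tree: a connected triangle graph without cycles. -/
def IsTriangleTree (V : Finset α) (E : Finset (Finset α)) : Prop :=
  IsTriangleGraph V E ∧ ¬ HasTriCycle E ∧ V.Nonempty ∧
    ∀ x ∈ V, ∀ y ∈ V, TriReach E x y

end TriangleGraphs

section Basic

variable {α : Type*} [LinearOrder α] [DecidableEq α]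

/-- Basic triangle trees (with respect to the linear order on labels), defined inductively:
a single point is basic, and a nontrivial triangle tree is basic iff its two smallest
vertices lie on a common triangle whose removal leaves three basic components. -/
inductive IsBasicTree : Finset α → Finset (Finset α) → Prop
  | single (x : α) : IsBasicTree {x} ∅
  | node (a b c : α) (V₁ V₂ V₃ : Finset α) (E₁ E₂ E₃ : Finset (Finset α))
      (ha : a ∈ V₁) (hb : b ∈ V₂) (hc : c ∈ V₃)
      (h12 : Disjoint V₁ V₂) (h13 : Disjoint V₁ V₃) (h23 : Disjoint V₂ V₃)
      (hmin : ∀ x ∈ V₁ ∪ V₂ ∪ V₃, x ≠ a → a < x)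
      (hmin2 : ∀ x ∈ V₁ ∪ V₂ ∪ V₃, x ≠ a → x ≠ b → b < x)
      (t1 : IsBasicTree V₁ E₁) (t2 : IsBasicTree V₂ E₂) (t3 : IsBasicTree V₃ E₃) :
      IsBasicTree (V₁ ∪ V₂ ∪ V₃) (insert ({a, b, c} : Finset α) (E₁ ∪ E₂ ∪ E₃))

end Basic

/-- The number of basic triangle trees on the ordered vertex set `{1, …, m}`. -/
noncomputable def basicTreeCount (m : ℕ) : ℕ :=
  Nat.card {E : Finset (Finset (Fin m)) //
    IsTriangleTree (Finset.univ : Finset (Fin m)) E ∧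
    IsBasicTree (Finset.univ : Finset (Fin m)) E}

namespace BT

theorem tree_of_basic {N : ℕ} {V : Finset (Fin N)} {E : Finset (Finset (Fin N))}
    (h : IsBasicTree V E) : IsTriangleTree V E := by
  induction h with
  | single x =>
    refine ⟨?_, ?_, by simp, ?_⟩
    · intro e he; simp at he
    · rintro ⟨n, e, v, hn, h1, -⟩
      have := h1 1 le_rfl (by omega)
      simp at this
    · intro x hx y hy
      simp at hx hy; subst hx; subst hy
      exact Relation.ReflTransGen.refl
  | node a b c V₁ V₂ V₃ E₁ E₂ E₃ ha hb hc h12 h13 h23 hmin hmin2 t1 t2 t3 i1 i2 i3 =>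
    obtain ⟨g1, c1, n1, r1⟩ := i1
    obtain ⟨g2, c2, n2, r2⟩ := i2
    obtain ⟨g3, c3, n3, r3⟩ := i3
    have hab : a ≠ b := fun h => Finset.disjoint_left.1 h12 ha (h ▸ hb)
    have hac : a ≠ c := fun h => Finset.disjoint_left.1 h13 ha (h ▸ hc)
    have hbc : b ≠ c := fun h => Finset.disjoint_left.1 h23 hb (h ▸ hc)
    rw [Finset.disjoint_left] at h12 h13 h23
    refine ⟨?_, ?_, ⟨a, by simp [ha]⟩, ?_⟩
    · intro e he
      simp only [Finset.mem_insert, Finset.mem_union] at he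
      rcases he with rfl | (he | he) | he
      · refine ⟨Finset.card_eq_three.2 ⟨a, b, c, hab, hac, hbc, rfl⟩, ?_⟩
        intro x hx
        simp only [Finset.mem_insert, Finset.mem_singleton] at hx
        rcases hx with rfl | rfl | rfl <;> simp [*]
      · exact ⟨(g1 e he).1, (g1 e he).2.trans (by intro x hx; simp [hx])⟩
      · exact ⟨(g2 e he).1, (g2 e he).2.trans (by intro x hx; simp [hx])⟩
      · exact ⟨(g3 e he).1, (g3 e he).2.trans (by intro x hx; simp [hx])⟩
    · rintro ⟨n, e, v, hn, he, hed, hvd, hv0, h0, hnn, hv⟩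
      classical
      let col : Fin N → ℕ := fun x => if x ∈ V₁ then 1 else if x ∈ V₂ then 2 else 3
      have k1 : ∀ e ∈ E₁, ∀ x ∈ e, col x = 1 := by
        intro e he x hx
        simp [col, (g1 e he).2 hx]
      have k2 : ∀ e ∈ E₂, ∀ x ∈ e, col x = 2 := by
        intro e he x hx
        have := (g2 e he).2 hx
        have h' : x ∉ V₁ := fun h => h12 h this
        simp [col, this, h']
      have k3 : ∀ e ∈ E₃, ∀ x ∈ e, col x = 3 := by
        intro e he x hx
        have := (g3 e he).2 hx
        have h' : x ∉ V₁ := fun h => h13 h this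
        have h'' : x ∉ V₂ := fun h => h23 h this
        simp [col, h'', h']
      have ca : col a = 1 := by simp [col, ha]
      have cb : col b = 2 := by
        have h' : b ∉ V₁ := fun h => h12 h hb
        simp [col, hb, h']
      have cc : col c = 3 := by
        have h' : c ∉ V₁ := fun h => h13 h hc
        have h'' : c ∉ V₂ := fun h => h23 h hc
        simp [col, h'', h']
      have hL : ∀ i, i < n → v i ∈ e (i + 1) := by
        intro i hi
        rcases Nat.eq_zero_or_pos i with rfl | hp
        · simpa using h0
        · exact (hv i hp hi).2
      have hR : ∀ i, i < n → v (i + 1) ∈ e (i + 1) := by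
        intro i hi
        rcases Nat.lt_or_ge (i + 1) n with h | h
        · exact (hv (i + 1) (by omega) h).1
        · have : i + 1 = n := by omega
          rw [this]; exact hnn
      have hstep : ∀ i, i < n → e (i + 1) ≠ {a, b, c} → col (v i) = col (v (i + 1)) := by
        intro i hi hne
        have hm := he (i + 1) (by omega) (by omega)
        simp only [Finset.mem_insert, Finset.mem_union] at hm
        rcases hm with hm | (hm | hm) | hm
        · exact absurd hm hne
        · rw [k1 _ hm _ (hL i hi), k1 _ hm _ (hR i hi)]
        · rw [k2 _ hm _ (hL i hi), k2 _ hm _ (hR i hi)]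
        · rw [k3 _ hm _ (hL i hi), k3 _ hm _ (hR i hi)]
      have hchain : ∀ i j, i ≤ j → j ≤ n → (∀ k, i ≤ k → k < j → e (k + 1) ≠ {a, b, c}) →
          col (v i) = col (v j) := by
        intro i j hij
        induction j, hij using Nat.le_induction with
        | base => intros; rfl
        | succ j hij ih =>
          intro hj hk
          rw [ih (by omega) (fun k h1 h2 => hk k h1 (by omega)),
            hstep j (by omega) (hk j hij (by omega))]
      by_cases hex : ∃ i, i < n ∧ e (i + 1) = {a, b, c}
      · obtain ⟨i, hi, hei⟩ := hex
        have hother : ∀ k, k < n → k ≠ i → e (k + 1) ≠ {a, b, c} := by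
          intro k hk hki h
          rcases Nat.lt_or_gt_of_ne hki with hlt | hlt
          · exact hed (k + 1) (i + 1) (by omega) (by omega) (by omega) (h.trans hei.symm)
          · exact hed (i + 1) (k + 1) (by omega) (by omega) (by omega) (hei.trans h.symm)
        have e1 := hchain 0 i (by omega) (by omega) (fun k _ h => hother k (by omega) (by omega))
        have e2 := hchain (i + 1) n (by omega) (by omega)
          (fun k _ h => hother k (by omega) (by omega))
        have e3 : col (v i) = col (v (i + 1)) := by rw [← e1, e2, hv0]
        have m1 := hL i hi
        have m2 := hR i hi
        rw [hei] at m1 m2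
        simp only [Finset.mem_insert, Finset.mem_singleton] at m1 m2
        have heq : v i = v (i + 1) := by
          rcases m1 with m1 | m1 | m1 <;> rcases m2 with m2 | m2 | m2 <;>
            rw [m1, m2] at e3 ⊢ <;> simp [ca, cb, cc] at e3
        rcases Nat.lt_or_ge (i + 1) n with h | h
        · exact hvd i (i + 1) (by omega) h heq
        · have : i + 1 = n := by omega
          rw [this, hv0] at heq
          exact hvd 0 i (by omega) hi heq.symm
      · push Not at hex
        have hall : ∀ i, i < n → col (v (i + 1)) = col (v 0) := by
          intro i hi
          exact (hchain 0 (i + 1) (by omega) (by omega) (fun k _ h => hex k (by omega))).symm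
        have hsame : ∀ i, 1 ≤ i → i ≤ n → ∃ k, (k = 1 ∧ e i ∈ E₁ ∨ k = 2 ∧ e i ∈ E₂ ∨ k = 3 ∧ e i ∈ E₃)
            ∧ k = col (v 0) := by
          intro i h1 hi
          obtain ⟨i, rfl⟩ : ∃ j, i = j + 1 := ⟨i - 1, by omega⟩
          have hm := he (i + 1) (by omega) (by omega)
          have hh := hall i (by omega)
          have hr := hR i (by omega)
          simp only [Finset.mem_insert, Finset.mem_union] at hm
          rcases hm with hm | (hm | hm) | hm
          · exact absurd hm (hex i (by omega))
          · exact ⟨1, by simp [hm], by rw [← hh, k1 _ hm _ hr]⟩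
          · exact ⟨2, by simp [hm], by rw [← hh, k2 _ hm _ hr]⟩
          · exact ⟨3, by simp [hm], by rw [← hh, k3 _ hm _ hr]⟩
        obtain ⟨k, hk, hk0⟩ := hsame 1 le_rfl (by omega)
        rcases hk with ⟨rfl, -⟩ | ⟨rfl, -⟩ | ⟨rfl, -⟩
        · refine c1 ⟨n, e, v, hn, ?_, hed, hvd, hv0, h0, hnn, hv⟩
          intro i hi1 hi2
          obtain ⟨k, hk, hk1⟩ := hsame i hi1 hi2
          rw [← hk0] at hk1; subst hk1
          simpa using hk
        · refine c2 ⟨n, e, v, hn, ?_, hed, hvd, hv0, h0, hnn, hv⟩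
          intro i hi1 hi2
          obtain ⟨k, hk, hk1⟩ := hsame i hi1 hi2
          rw [← hk0] at hk1; subst hk1
          simpa using hk
        · refine c3 ⟨n, e, v, hn, ?_, hed, hvd, hv0, h0, hnn, hv⟩
          intro i hi1 hi2
          obtain ⟨k, hk, hk1⟩ := hsame i hi1 hi2
          rw [← hk0] at hk1; subst hk1
          simpa using hk
    · set E := insert ({a, b, c} : Finset (Fin N)) (E₁ ∪ E₂ ∪ E₃) with hE
      have mono : ∀ E' : Finset (Finset (Fin N)), E' ⊆ E → ∀ x y, TriReach E' x y → TriReach E x y := by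
        intro E' hE' x y h
        unfold TriReach at h ⊢
        induction h with
        | refl => exact Relation.ReflTransGen.refl
        | tail _ hs ih =>
          obtain ⟨e, he, h⟩ := hs
          exact ih.tail ⟨e, hE' he, h⟩
      have s1 : E₁ ⊆ E := by intro x hx; simp [hE, hx]
      have s2 : E₂ ⊆ E := by intro x hx; simp [hE, hx]
      have s3 : E₃ ⊆ E := by intro x hx; simp [hE, hx]
      have st : ∀ x ∈ ({a, b, c} : Finset (Fin N)), ∀ y ∈ ({a, b, c} : Finset (Fin N)), TriReach E x y :=
        fun x hx y hy => Relation.ReflTransGen.single ⟨_, Finset.mem_insert_self _ _, hx, hy⟩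
      have key : ∀ x ∈ V₁ ∪ V₂ ∪ V₃, TriReach E x a ∧ TriReach E a x := by
        intro x hx
        simp only [Finset.mem_union] at hx
        rcases hx with (hx | hx) | hx
        · exact ⟨mono _ s1 _ _ (r1 x hx a ha), mono _ s1 _ _ (r1 a ha x hx)⟩
        · exact ⟨(mono _ s2 _ _ (r2 x hx b hb)).trans (st b (by simp) a (by simp)),
            (st a (by simp) b (by simp)).trans (mono _ s2 _ _ (r2 b hb x hx))⟩
        · exact ⟨(mono _ s3 _ _ (r3 x hx c hc)).trans (st c (by simp) a (by simp)),
            (st a (by simp) c (by simp)).trans (mono _ s3 _ _ (r3 c hc x hx))⟩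
      intro x hx y hy
      exact (key x hx).1.trans (key y hy).2

theorem odd_card {N : ℕ} {V : Finset (Fin N)} {E : Finset (Finset (Fin N))}
    (h : IsBasicTree V E) : Odd V.card := by
  induction h with
  | single x => simp
  | node a b c V₁ V₂ V₃ E₁ E₂ E₃ ha hb hc h12 h13 h23 hmin hmin2 t1 t2 t3 i1 i2 i3 =>
    rw [Finset.card_union_of_disjoint (by simp [h13, h23]), Finset.card_union_of_disjoint h12]
    exact (i1.add_odd i2).add_odd i3

theorem sub_of_reach {N : ℕ} {V₁ W₁ W₂ W₃ : Finset (Fin N)} {E₁ F₁ F₂ F₃ : Finset (Finset (Fin N))}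
    {a : Fin N} (t : IsTriangleTree V₁ E₁) (ha : a ∈ V₁) (hs : E₁ ⊆ F₁ ∪ F₂ ∪ F₃)
    (g1 : IsTriangleGraph W₁ F₁) (g2 : IsTriangleGraph W₂ F₂) (g3 : IsTriangleGraph W₃ F₃)
    (d2 : Disjoint W₁ W₂) (d3 : Disjoint W₁ W₃) (haW : a ∈ W₁) : V₁ ⊆ W₁ ∧ E₁ ⊆ F₁ := by
  rw [Finset.disjoint_left] at d2 d3
  have hV : V₁ ⊆ W₁ := by
    intro x hx
    have hr := t.2.2.2 a ha x hx
    clear hx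
    unfold TriReach at hr
    induction hr with
    | refl => exact haW
    | tail _ hst ih =>
      obtain ⟨e, he, h1, h2⟩ := hst
      have := hs he
      simp only [Finset.mem_union] at this
      rcases this with (h | h) | h
      · exact (g1 e h).2 h2
      · exact absurd ((g2 e h).2 h1) (d2 ih)
      · exact absurd ((g3 e h).2 h1) (d3 ih)
  refine ⟨hV, fun e he => ?_⟩
  have hc := t.1 e he
  obtain ⟨x, hx⟩ : e.Nonempty := by
    rw [← Finset.card_pos]; omega
  have hxW := hV (hc.2 hx)
  have := hs he
  simp only [Finset.mem_union] at this
  rcases this with (h | h) | h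
  · exact h
  · exact absurd ((g2 e h).2 hx) (d2 hxW)
  · exact absurd ((g3 e h).2 hx) (d3 hxW)

theorem node_unique {N : ℕ} {a b c c' : Fin N} {V₁ V₂ V₃ W₁ W₂ W₃ : Finset (Fin N)}
    {E₁ E₂ E₃ F₁ F₂ F₃ : Finset (Finset (Fin N))}
    (ha : a ∈ V₁) (hb : b ∈ V₂) (hc : c ∈ V₃) (ha' : a ∈ W₁) (hb' : b ∈ W₂) (hc' : c' ∈ W₃)
    (h12 : Disjoint V₁ V₂) (h13 : Disjoint V₁ V₃) (h23 : Disjoint V₂ V₃)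
    (k12 : Disjoint W₁ W₂) (k13 : Disjoint W₁ W₃) (k23 : Disjoint W₂ W₃)
    (t1 : IsTriangleTree V₁ E₁) (t2 : IsTriangleTree V₂ E₂) (t3 : IsTriangleTree V₃ E₃)
    (s1 : IsTriangleTree W₁ F₁) (s2 : IsTriangleTree W₂ F₂) (s3 : IsTriangleTree W₃ F₃)
    (heq : insert ({a, b, c} : Finset (Fin N)) (E₁ ∪ E₂ ∪ E₃) =
      insert ({a, b, c'} : Finset (Fin N)) (F₁ ∪ F₂ ∪ F₃)) :
    c = c' ∧ V₁ = W₁ ∧ V₂ = W₂ ∧ V₃ = W₃ ∧ E₁ = F₁ ∧ E₂ = F₂ ∧ E₃ = F₃ := by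
  have aux : ∀ {V₁ V₂ V₃ : Finset (Fin N)} {E₁ E₂ E₃ : Finset (Finset (Fin N))},
      a ∈ V₁ → b ∈ V₂ → Disjoint V₁ V₂ → Disjoint V₁ V₃ → Disjoint V₂ V₃ →
      IsTriangleTree V₁ E₁ → IsTriangleTree V₂ E₂ → IsTriangleTree V₃ E₃ →
      ∀ x, ({a, b, x} : Finset (Fin N)) ∉ E₁ ∪ E₂ ∪ E₃ := by
    intro V₁ V₂ V₃ E₁ E₂ E₃ ha hb h12 h13 h23 t1 t2 t3 x hx
    rw [Finset.disjoint_left] at h12 h13 h23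
    simp only [Finset.mem_union] at hx
    rcases hx with (h | h) | h
    · exact h12 ((t1.1 _ h).2 (by simp)) hb
    · exact h12 ha ((t2.1 _ h).2 (by simp))
    · exact h13 ha ((t3.1 _ h).2 (by simp))
  have nE := aux ha hb h12 h13 h23 t1 t2 t3
  have nF := aux ha' hb' k12 k13 k23 s1 s2 s3
  have hac : c ≠ a := fun h => Finset.disjoint_left.1 h13 ha (h ▸ hc)
  have hbc : c ≠ b := fun h => Finset.disjoint_left.1 h23 hb (h ▸ hc)
  have he : ({a, b, c} : Finset (Fin N)) = {a, b, c'} := by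
    have : ({a, b, c} : Finset (Fin N)) ∈ insert ({a, b, c'} : Finset (Fin N)) (F₁ ∪ F₂ ∪ F₃) := by
      rw [← heq]; exact Finset.mem_insert_self _ _
    rcases Finset.mem_insert.1 this with h | h
    · exact h
    · exact absurd h (nF c)
  have hcc : c = c' := by
    have : c ∈ ({a, b, c'} : Finset (Fin N)) := by rw [← he]; simp
    simpa [hac, hbc] using this
  subst hcc
  have hU : E₁ ∪ E₂ ∪ E₃ = F₁ ∪ F₂ ∪ F₃ := by
    rw [← Finset.erase_insert (nE c), heq, Finset.erase_insert (nF c)]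
  have p1 : E₁ ∪ E₂ ∪ E₃ = E₂ ∪ E₁ ∪ E₃ := by rw [Finset.union_comm E₁]
  have p2 : E₁ ∪ E₂ ∪ E₃ = E₃ ∪ E₁ ∪ E₂ := by rw [Finset.union_comm, Finset.union_assoc]
  have q1 : F₁ ∪ F₂ ∪ F₃ = F₂ ∪ F₁ ∪ F₃ := by rw [Finset.union_comm F₁]
  have q2 : F₁ ∪ F₂ ∪ F₃ = F₃ ∪ F₁ ∪ F₂ := by rw [Finset.union_comm, Finset.union_assoc]
  have b1 : E₁ ⊆ E₁ ∪ E₂ ∪ E₃ := by intro x hx; simp [hx]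
  have b2 : E₂ ⊆ E₁ ∪ E₂ ∪ E₃ := by intro x hx; simp [hx]
  have b3 : E₃ ⊆ E₁ ∪ E₂ ∪ E₃ := by intro x hx; simp [hx]
  have d1 : F₁ ⊆ F₁ ∪ F₂ ∪ F₃ := by intro x hx; simp [hx]
  have d2 : F₂ ⊆ F₁ ∪ F₂ ∪ F₃ := by intro x hx; simp [hx]
  have d3 : F₃ ⊆ F₁ ∪ F₂ ∪ F₃ := by intro x hx; simp [hx]
  have A1 := sub_of_reach t1 ha (hU ▸ b1) s1.1 s2.1 s3.1 k12 k13 ha'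
  have A2 := sub_of_reach t2 hb (q1 ▸ hU ▸ b2) s2.1 s1.1 s3.1 k12.symm k23 hb'
  have A3 := sub_of_reach t3 hc (q2 ▸ hU ▸ b3) s3.1 s1.1 s2.1 k13.symm k23.symm hc'
  have B1 := sub_of_reach s1 ha' (hU ▸ d1) t1.1 t2.1 t3.1 h12 h13 ha
  have B2 := sub_of_reach s2 hb' (p1 ▸ hU ▸ d2) t2.1 t1.1 t3.1 h12.symm h23 hb
  have B3 := sub_of_reach s3 hc' (p2 ▸ hU ▸ d3) t3.1 t1.1 t2.1 h13.symm h23.symm hc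
  exact ⟨rfl, A1.1.antisymm B1.1, A2.1.antisymm B2.1, A3.1.antisymm B3.1,
    A1.2.antisymm B1.2, A2.2.antisymm B2.2, A3.2.antisymm B3.2⟩

open Classical in
/-- The set of basic tree structures on `V`. -/
noncomputable def trees {N : ℕ} (V : Finset (Fin N)) : Finset (Finset (Finset (Fin N))) :=
  Finset.univ.filter (fun E => IsBasicTree V E)

theorem mem_trees {N : ℕ} {V : Finset (Fin N)} {E : Finset (Finset (Fin N))} :
    E ∈ trees V ↔ IsBasicTree V E := by
  simp [trees]

theorem trees_card_rec {N : ℕ} (a b : Fin N) (R : Finset (Fin N)) (hab : a < b)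
    (hR : ∀ x ∈ R, b < x) :
    (trees (insert a (insert b R))).card =
      ∑ S ∈ R.powerset, ∑ T ∈ (R \ S).powerset,
        ((R \ S) \ T).card * ((trees (insert a S)).card * ((trees (insert b T)).card *
          (trees ((R \ S) \ T)).card)) := by
  have haR : a ∉ R := fun h => absurd (hR a h) (by simpa using hab.le)
  have hbR : b ∉ R := fun h => absurd (hR b h) (by simp)
  have dis : ∀ S ⊆ R, ∀ T ⊆ R \ S, Disjoint (insert a S) (insert b T) ∧
      Disjoint (insert a S) ((R \ S) \ T) ∧ Disjoint (insert b T) ((R \ S) \ T) := by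
    intro S hS T hT
    have hTR : T ⊆ R := hT.trans Finset.sdiff_subset
    refine ⟨?_, ?_, ?_⟩
    · rw [Finset.disjoint_left]
      intro x hx hx'
      rw [Finset.mem_insert] at hx hx'
      rcases hx with rfl | hx <;> rcases hx' with h | hx'
      · exact hab.ne h
      · exact haR (hTR hx')
      · exact hbR (h ▸ hS hx)
      · exact (Finset.mem_sdiff.1 (hT hx')).2 hx
    · rw [Finset.disjoint_left]
      intro x hx hx'
      rw [Finset.mem_sdiff, Finset.mem_sdiff] at hx'
      rw [Finset.mem_insert] at hx
      rcases hx with rfl | hx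
      · exact haR hx'.1.1
      · exact hx'.1.2 hx
    · rw [Finset.disjoint_left]
      intro x hx hx'
      rw [Finset.mem_sdiff, Finset.mem_sdiff] at hx'
      rw [Finset.mem_insert] at hx
      rcases hx with rfl | hx
      · exact hbR hx'.1.1
      · exact hx'.2 hx
  have hun : ∀ S ⊆ R, ∀ T ⊆ R \ S,
      insert a S ∪ insert b T ∪ ((R \ S) \ T) = insert a (insert b R) := by
    intro S hS T hT
    ext x
    have h1 := @hS x
    have h2 := @hT x
    simp only [Finset.mem_union, Finset.mem_insert, Finset.mem_sdiff] at *
    tauto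
  have hcard : ∑ S ∈ R.powerset, ∑ T ∈ (R \ S).powerset,
        ((R \ S) \ T).card * ((trees (insert a S)).card * ((trees (insert b T)).card *
          (trees ((R \ S) \ T)).card)) =
      (R.powerset.sigma fun S => (R \ S).powerset.sigma fun T =>
        ((R \ S) \ T) ×ˢ (trees (insert a S) ×ˢ (trees (insert b T) ×ˢ
          trees ((R \ S) \ T)))).card := by
    simp only [Finset.card_sigma, Finset.card_product]
  rw [hcard]
  symm
  refine Finset.card_bij (fun p _ => insert ({a, b, p.2.2.1} : Finset (Fin N))
    (p.2.2.2.1 ∪ p.2.2.2.2.1 ∪ p.2.2.2.2.2)) ?_ ?_ ?_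
  · rintro ⟨S, T, c, E₁, E₂, E₃⟩ hp
    simp only [Finset.mem_sigma, Finset.mem_powerset, Finset.mem_product, mem_trees] at hp
    obtain ⟨hS, hT, hc, t1, t2, t3⟩ := hp
    obtain ⟨d1, d2, d3⟩ := dis S hS T hT
    rw [mem_trees, ← hun S hS T hT]
    refine IsBasicTree.node a b c _ _ _ E₁ E₂ E₃ (by simp) (by simp) hc d1 d2 d3 ?_ ?_ t1 t2 t3
    · rw [hun S hS T hT]
      intro x hx hxa
      simp only [Finset.mem_insert] at hx
      rcases hx with h | rfl | h
      · exact absurd h hxa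
      · exact hab
      · exact hab.trans (hR x h)
    · rw [hun S hS T hT]
      intro x hx hxa hxb
      simp only [Finset.mem_insert, hxa, hxb, false_or] at hx
      exact hR x hx
  · rintro ⟨S, T, c, E₁, E₂, E₃⟩ hp ⟨S', T', c', E₁', E₂', E₃'⟩ hp' heq
    simp only [Finset.mem_sigma, Finset.mem_powerset, Finset.mem_product, mem_trees] at hp hp'
    obtain ⟨hS, hT, hc, t1, t2, t3⟩ := hp
    obtain ⟨d1, d2, d3⟩ := dis S hS T hT
    obtain ⟨hS', hT', hc', t1', t2', t3'⟩ := hp'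
    obtain ⟨d1', d2', d3'⟩ := dis S' hS' T' hT'
    obtain ⟨rfl, h1, h2, h3, rfl, rfl, rfl⟩ := node_unique (a := a) (b := b)
      (by simp) (by simp) hc (by simp) (by simp) hc'
      d1 d2 d3 d1' d2' d3' (tree_of_basic t1) (tree_of_basic t2) (tree_of_basic t3)
      (tree_of_basic t1') (tree_of_basic t2') (tree_of_basic t3') heq
    have hSS : S = S' := by
      rw [← Finset.erase_insert (fun h => haR (hS h)), h1,
        Finset.erase_insert (fun h => haR (hS' h))]
    have hTT : T = T' := by
      rw [← Finset.erase_insert (fun h => hbR (Finset.sdiff_subset (hT h))), h2,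
        Finset.erase_insert (fun h => hbR (Finset.sdiff_subset (hT' h)))]
    subst hSS; subst hTT; rfl
  · intro E hE
    rw [mem_trees] at hE
    generalize hV : insert a (insert b R) = V at hE
    cases hE with
    | single x =>
      have h1 : a ∈ ({x} : Finset (Fin N)) := by rw [← hV]; simp
      have h2 : b ∈ ({x} : Finset (Fin N)) := by rw [← hV]; simp
      simp only [Finset.mem_singleton] at h1 h2
      exact absurd (h1.trans h2.symm) hab.ne
    | node a' b' c V₁ V₂ V₃ E₁ E₂ E₃ ha hb hc h12 h13 h23 hmin hmin2 t1 t2 t3 =>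
      rw [← hV] at hmin hmin2
      have hlow : ∀ x ∈ insert a (insert b R), x ≠ a → a < x := by
        intro x hx hxa
        simp only [Finset.mem_insert] at hx
        rcases hx with h | rfl | h
        · exact absurd h hxa
        · exact hab
        · exact hab.trans (hR x h)
      have ha'V : a' ∈ insert a (insert b R) := by rw [hV]; simp [ha]
      have hb'V : b' ∈ insert a (insert b R) := by rw [hV]; simp [hb]
      have haa : a' = a := by
        by_contra hne
        exact absurd (hlow a' ha'V hne) (not_lt.2 (hmin a (by simp) (Ne.symm hne)).le)
      subst haa
      have hab' : a' ≠ b' := fun h => Finset.disjoint_left.1 h12 ha (h ▸ hb)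
      have hbb : b' = b := by
        by_contra hne
        have h1 := hmin2 b (by simp) hab.ne' (Ne.symm hne)
        simp only [Finset.mem_insert, hab'.symm, hne, false_or] at hb'V
        exact absurd h1 (not_lt.2 (hR _ hb'V).le)
      subst hbb
      rw [Finset.disjoint_left] at h12 h13 h23
      have e1 : insert a' (V₁.erase a') = V₁ := Finset.insert_erase ha
      have e2 : insert b' (V₂.erase b') = V₂ := Finset.insert_erase hb
      have hmemV : ∀ x, (x = a' ∨ x = b' ∨ x ∈ R) ↔ (x ∈ V₁ ∨ x ∈ V₂) ∨ x ∈ V₃ := by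
        intro x
        have : x ∈ insert a' (insert b' R) ↔ x ∈ V₁ ∪ V₂ ∪ V₃ := by rw [hV]
        simpa [or_assoc] using this
      have hS : V₁.erase a' ⊆ R := by
        intro x hx
        rw [Finset.mem_erase] at hx
        rcases (hmemV x).2 (Or.inl (Or.inl hx.2)) with h | h | h
        · exact absurd h hx.1
        · exact absurd hb (h ▸ h12 hx.2)
        · exact h
      have hT : V₂.erase b' ⊆ R \ V₁.erase a' := by
        intro x hx
        rw [Finset.mem_erase] at hx
        rw [Finset.mem_sdiff, Finset.mem_erase]
        refine ⟨?_, fun h => h12 h.2 hx.2⟩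
        rcases (hmemV x).2 (Or.inl (Or.inr hx.2)) with h | h | h
        · exact absurd hx.2 (h ▸ h12 ha)
        · exact absurd h hx.1
        · exact h
      have e3 : (R \ V₁.erase a') \ V₂.erase b' = V₃ := by
        ext x
        simp only [Finset.mem_sdiff, Finset.mem_erase]
        constructor
        · rintro ⟨⟨hx, h1⟩, h2⟩
          have hxa : x ≠ a' := fun h => haR (h ▸ hx)
          have hxb : x ≠ b' := fun h => hbR (h ▸ hx)
          rcases (hmemV x).1 (Or.inr (Or.inr hx)) with (h | h) | h
          · exact absurd ⟨hxa, h⟩ h1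
          · exact absurd ⟨hxb, h⟩ h2
          · exact h
        · intro hx
          refine ⟨⟨?_, fun h => h13 h.2 hx⟩, fun h => h23 h.2 hx⟩
          rcases (hmemV x).2 (Or.inr hx) with h | h | h
          · exact absurd hx (h ▸ h13 ha)
          · exact absurd hx (h ▸ h23 hb)
          · exact h
      refine ⟨⟨V₁.erase a', V₂.erase b', c, E₁, E₂, E₃⟩, ?_, rfl⟩
      simp only [Finset.mem_sigma, Finset.mem_powerset, Finset.mem_product, mem_trees]
      rw [e1, e2, e3]
      exact ⟨hS, hT, hc, t1, t2, t3⟩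

/-- The numerical recursion. -/
def F : ℕ → ℕ
  | 0 => 0
  | 1 => 1
  | (m + 2) => ∑ i : Fin (m + 1), m.choose i * ∑ j : Fin (m - i + 1), (m - i).choose j *
      ((m - i - j) * (F (i + 1) * (F (j + 1) * F (m - i - j))))
  termination_by n => n
  decreasing_by all_goals omega

theorem F_rec (m : ℕ) : F (m + 2) = ∑ i ∈ Finset.range (m + 1), m.choose i *
    ∑ j ∈ Finset.range (m - i + 1), (m - i).choose j *
      ((m - i - j) * (F (i + 1) * (F (j + 1) * F (m - i - j)))) := by
  rw [F]
  rw [Finset.sum_range]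
  refine Finset.sum_congr rfl fun i _ => ?_
  rw [Finset.sum_range]

theorem trees_card {N : ℕ} (n : ℕ) : ∀ V : Finset (Fin N), V.card = n → (trees V).card = F n := by
  induction n using Nat.strong_induction_on with
  | _ n ih =>
    intro V hV
    match n with
    | 0 =>
      rw [F, Finset.card_eq_zero, Finset.eq_empty_iff_forall_notMem]
      intro E hE
      have := odd_card (mem_trees.1 hE)
      rw [hV] at this
      simp at this
    | 1 =>
      obtain ⟨x, rfl⟩ := Finset.card_eq_one.1 hV
      rw [F, Finset.card_eq_one]
      refine ⟨∅, ?_⟩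
      ext E
      rw [mem_trees, Finset.mem_singleton]
      constructor
      · intro h
        by_contra hne
        obtain ⟨e, he⟩ := Finset.nonempty_iff_ne_empty.2 hne
        obtain ⟨h1, h2⟩ := (tree_of_basic h).1 e he
        have := Finset.card_le_card h2
        simp at this; omega
      · rintro rfl
        exact IsBasicTree.single x
    | m + 2 =>
      have hne : V.Nonempty := by rw [← Finset.card_pos]; omega
      set a := V.min' hne with ha
      have haV : a ∈ V := V.min'_mem hne
      have hc1 : (V.erase a).card = m + 1 := by rw [Finset.card_erase_of_mem haV]; omega
      have hne1 : (V.erase a).Nonempty := by rw [← Finset.card_pos]; omega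
      set b := (V.erase a).min' hne1 with hb
      have hbV : b ∈ V.erase a := (V.erase a).min'_mem hne1
      set R := (V.erase a).erase b with hRdef
      have hcR : R.card = m := by rw [hRdef, Finset.card_erase_of_mem hbV]; omega
      have hVeq : V = insert a (insert b R) := by
        rw [hRdef, Finset.insert_erase hbV, Finset.insert_erase haV]
      have hab : a < b := by
        rw [Finset.mem_erase] at hbV
        exact lt_of_le_of_ne (V.min'_le b hbV.2) hbV.1.symm
      have hR : ∀ x ∈ R, b < x := by
        intro x hx
        rw [hRdef, Finset.mem_erase] at hx
        exact lt_of_le_of_ne ((V.erase a).min'_le x hx.2) hx.1.symm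
      have haR : a ∉ R := fun h => absurd (hR a h) (by simpa using hab.le)
      have hbR : b ∉ R := fun h => absurd (hR b h) (by simp)
      clear_value a b R
      rw [hVeq, trees_card_rec a b R hab hR, F_rec]
      have step : ∀ S ∈ R.powerset, ∑ T ∈ (R \ S).powerset,
        ((R \ S) \ T).card * ((trees (insert a S)).card * ((trees (insert b T)).card *
          (trees ((R \ S) \ T)).card)) =
          (fun i => ∑ j ∈ Finset.range (m - i + 1), (m - i).choose j *
            ((m - i - j) * (F (i + 1) * (F (j + 1) * F (m - i - j))))) S.card := by
        intro S hS
        rw [Finset.mem_powerset] at hS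
        have hSc := Finset.card_le_card hS
        have hRS : (R \ S).card = m - S.card := by rw [Finset.card_sdiff_of_subset hS, hcR]
        have step2 : ∀ T ∈ (R \ S).powerset,
          ((R \ S) \ T).card * ((trees (insert a S)).card * ((trees (insert b T)).card *
          (trees ((R \ S) \ T)).card)) =
          (fun j => ((m - S.card - j) * (F (S.card + 1) * (F (j + 1) * F (m - S.card - j))))) T.card := by
          intro T hT
          rw [Finset.mem_powerset] at hT
          have hTc := Finset.card_le_card hT
          have hd : ((R \ S) \ T).card = m - S.card - T.card := by
            rw [Finset.card_sdiff_of_subset hT, hRS]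
          have c1 : (insert a S).card = S.card + 1 :=
            Finset.card_insert_of_notMem fun h => haR (hS h)
          have c2 : (insert b T).card = T.card + 1 :=
            Finset.card_insert_of_notMem fun h => hbR (Finset.sdiff_subset (hT h))
          simp only
          rw [hd, ih (S.card + 1) (by omega) _ c1, ih (T.card + 1) (by omega) _ c2,
            ih _ (by omega) _ hd]
        rw [Finset.sum_congr rfl step2, Finset.sum_powerset_apply_card (fun j => (m - S.card - j) *
          (F (S.card + 1) * (F (j + 1) * F (m - S.card - j)))), hRS]
        simp only [smul_eq_mul]
      rw [Finset.sum_congr rfl step, Finset.sum_powerset_apply_card (fun i =>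
        ∑ j ∈ Finset.range (m - i + 1), (m - i).choose j *
          ((m - i - j) * (F (i + 1) * (F (j + 1) * F (m - i - j))))), hcR]
      simp only [smul_eq_mul]

theorem basicTreeCount_eq (m : ℕ) : basicTreeCount m = F m := by
  rw [← trees_card (N := m) m Finset.univ (by simp), basicTreeCount]
  refine Nat.subtype_card _ fun E => ?_
  rw [mem_trees]
  exact ⟨fun h => ⟨tree_of_basic h, h⟩, fun h => h.2⟩

theorem F_even (m : ℕ) (hm : ¬ Odd m) : F m = 0 := by
  rw [← trees_card (N := m) m Finset.univ (by simp), Finset.card_eq_zero,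
    Finset.eq_empty_iff_forall_notMem]
  intro E hE
  have := odd_card (mem_trees.1 hE)
  simp at this
  exact hm (by simpa using this)

/-- Coefficients of the derivative of the generating function. -/
noncomputable def cf (n : ℕ) : ℝ := (F (n + 1) : ℝ) / (n.factorial : ℝ)

theorem cf_nonneg (n : ℕ) : 0 ≤ cf n := by unfold cf; positivity

theorem cf_zero : cf 0 = 1 := by simp [cf, F]

theorem cf_odd (n : ℕ) (hn : Odd n) : cf n = 0 := by
  rw [cf, F_even (n + 1) (by simpa [Nat.odd_add_one] using hn)]
  simp

open PowerSeries in
/-- The derivative as a formal power series. -/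
noncomputable def gs : PowerSeries ℝ := PowerSeries.mk cf

open PowerSeries in
theorem coeff_Xgs (k : ℕ) : coeff k (X * gs) = (k : ℝ) * F k / (k.factorial : ℝ) := by
  cases k with
  | zero => simp
  | succ k =>
    rw [coeff_succ_X_mul, gs, coeff_mk, cf, Nat.factorial_succ]
    push_cast
    field_simp

open PowerSeries in
theorem gs_ode : derivative ℝ gs = gs * (gs * (X * gs)) := by
  ext m
  rw [coeff_derivative, coeff_mul, Finset.Nat.sum_antidiagonal_eq_sum_range_succ_mk]
  have h1 : coeff (m + 1) gs * ((m : ℝ) + 1) = (F (m + 2) : ℝ) / (m.factorial : ℝ) := by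
    rw [gs, coeff_mk, cf, Nat.factorial_succ]
    push_cast
    field_simp
  rw [h1, F_rec]
  push_cast
  rw [Finset.sum_div]
  refine Finset.sum_congr rfl fun i hi => ?_
  have hi' : i ≤ m := by simpa [Nat.lt_succ_iff] using hi
  rw [coeff_mul, Finset.Nat.sum_antidiagonal_eq_sum_range_succ_mk, Finset.mul_sum,
    Finset.mul_sum, Finset.sum_div]
  refine Finset.sum_congr rfl fun j hj => ?_
  have hj' : j ≤ m - i := by simpa [Nat.lt_succ_iff] using hj
  simp only [coeff_Xgs]
  simp only [gs, coeff_mk, cf]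
  have e1 := Nat.choose_mul_factorial_mul_factorial hi'
  have e2 := Nat.choose_mul_factorial_mul_factorial hj'
  have e3 : ((m - i - j : ℕ) : ℝ) = (m : ℝ) - i - j := by
    rw [Nat.cast_sub hj', Nat.cast_sub hi']
  rw [← e1, ← e2]
  have p1 : ((m.choose i : ℕ) : ℝ) ≠ 0 := by exact_mod_cast (Nat.choose_pos hi').ne'
  have p2 : (((m - i).choose j : ℕ) : ℝ) ≠ 0 := by exact_mod_cast (Nat.choose_pos hj').ne'
  push_cast
  field_simp

open PowerSeries in
theorem gs_sq : (1 - X ^ 2) * (gs * gs) = (1 : PowerSeries ℝ) := by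
  set z : PowerSeries ℝ := 1 - (1 - X ^ 2) * (gs * gs) with hz
  have hode : derivative ℝ z = X * (2 * (gs * gs) * z) := by
    have hX : derivative ℝ (X ^ 2 : PowerSeries ℝ) = 2 * X := by
      rw [derivative_pow, derivative_X]; simp
    rw [hz]
    simp only [map_sub, Derivation.leibniz, smul_eq_mul, derivative_one, hX, gs_ode]
    ring
  have hc : ∀ n, coeff n z = 0 := by
    intro n
    induction n using Nat.strong_induction_on with
    | _ n ih =>
      cases n with
      | zero =>
        simp [hz, gs, -map_sub]
        simp [cf_zero]
      | succ n =>
        have h := congrArg (coeff n) hode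
        rw [coeff_derivative] at h
        have h0 : coeff n (X * (2 * (gs * gs) * z)) = 0 := by
          rw [← mul_assoc, coeff_mul]
          refine Finset.sum_eq_zero fun p hp => ?_
          rw [ih p.2 (by have := Finset.HasAntidiagonal.mem_antidiagonal.1 hp; omega), mul_zero]
        rw [h0] at h
        have : ((n : ℝ) + 1) ≠ 0 := by positivity
        simpa [this] using h
  have : z = 0 := by ext n; simpa using hc n
  rw [hz, sub_eq_zero] at this
  exact this.symm

theorem cauchy (n : ℕ) : ∑ p ∈ Finset.HasAntidiagonal.antidiagonal n, cf p.1 * cf p.2 = if Even n then 1 else 0 := by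
  have hco : ∀ n, PowerSeries.coeff n (gs * gs) =
      ∑ p ∈ Finset.HasAntidiagonal.antidiagonal n, cf p.1 * cf p.2 := by
    intro n; simp [PowerSeries.coeff_mul, gs]
  rw [← hco]
  induction n using Nat.strong_induction_on with
  | _ n ih =>
    match n with
    | 0 => rw [hco]; simp [cf_zero]
    | 1 =>
      rw [hco]
      have : cf 1 = 0 := cf_odd 1 (by decide)
      simp [Finset.Nat.antidiagonal_succ, this]
    | n + 2 =>
      have h := congrArg (PowerSeries.coeff (n + 2)) gs_sq
      rw [sub_mul, one_mul, map_sub, PowerSeries.coeff_X_pow_mul, ih n (by omega)] at h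
      rw [PowerSeries.coeff_one, if_neg (Nat.succ_ne_zero (n + 1)), sub_eq_zero] at h
      rw [h]
      simp [Nat.even_add]

theorem cf_le_one (n : ℕ) : cf n ≤ 1 := by
  have h := cauchy n
  have h1 : cf 0 * cf n ≤ ∑ p ∈ Finset.HasAntidiagonal.antidiagonal n, cf p.1 * cf p.2 :=
    Finset.single_le_sum (f := fun p : ℕ × ℕ => cf p.1 * cf p.2)
      (fun p _ => mul_nonneg (cf_nonneg _) (cf_nonneg _)) (a := (0, n)) (by simp)
  rw [h, cf_zero, one_mul] at h1
  split_ifs at h1 <;> linarith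

theorem norm_term_le (u : ℝ) (n : ℕ) : ‖cf n * u ^ n‖ ≤ |u| ^ n := by
  rw [norm_mul, norm_pow, Real.norm_eq_abs, Real.norm_eq_abs, abs_of_nonneg (cf_nonneg n)]
  exact mul_le_of_le_one_left (by positivity) (cf_le_one n)

theorem summable_cf (u : ℝ) (hu : |u| < 1) : Summable fun n => ‖cf n * u ^ n‖ :=
  Summable.of_nonneg_of_le (fun _ => norm_nonneg _) (norm_term_le u)
    (summable_geometric_of_lt_one (abs_nonneg u) hu)

theorem sum_cf (u : ℝ) (hu : |u| < 1) : ∑' n, cf n * u ^ n = 1 / √(1 - u ^ 2) := by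
  have hu2 : u ^ 2 < 1 := by rwa [sq_lt_one_iff_abs_lt_one]
  have hsq : (∑' n, cf n * u ^ n) * (∑' n, cf n * u ^ n) = (1 - u ^ 2)⁻¹ := by
    rw [tsum_mul_tsum_eq_tsum_sum_antidiagonal_of_summable_norm (summable_cf u hu)
      (summable_cf u hu), ← tsum_geometric_of_lt_one (sq_nonneg u) hu2]
    have h1 : ∀ n, ∑ kl ∈ Finset.HasAntidiagonal.antidiagonal n, cf kl.1 * u ^ kl.1 * (cf kl.2 * u ^ kl.2) =
        (if Even n then 1 else 0) * u ^ n := by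
      intro n
      rw [← cauchy, Finset.sum_mul]
      refine Finset.sum_congr rfl fun p hp => ?_
      rw [← Finset.HasAntidiagonal.mem_antidiagonal.1 hp]
      ring
    simp_rw [h1]
    have hinj : Function.Injective (fun k : ℕ => 2 * k) := fun a b h => by simpa using h
    rw [← hinj.tsum_eq]
    · refine tsum_congr fun k => ?_
      simp [pow_mul]
    · intro n hn
      by_contra hne
      have : ¬ Even n := by
        rintro ⟨k, rfl⟩
        exact hne ⟨k, by simp; ring⟩
      simp [this] at hn
  have hpos : 0 ≤ ∑' n, cf n * u ^ n := by
    refine tsum_nonneg fun n => ?_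
    rcases Nat.even_or_odd n with h | h
    · exact mul_nonneg (cf_nonneg n) (h.pow_nonneg u)
    · rw [cf_odd n h, zero_mul]
  rw [one_div, ← Real.sqrt_inv, ← hsq, Real.sqrt_mul_self hpos]

theorem hasDeriv (u : ℝ) (hu : |u| < 1) :
    HasDerivAt (fun x : ℝ => ∑' n, cf n * x ^ (n + 1) / (n + 1 : ℝ)) (1 / √(1 - u ^ 2)) u := by
  obtain ⟨r, hr1, hr2⟩ := exists_between hu
  have hr0 : 0 < r := (abs_nonneg u).trans_lt hr1
  rw [← sum_cf u hu]
  refine hasDerivAt_tsum_of_isPreconnected (u := fun n => r ^ n) (t := Set.Ioo (-r) r) (y₀ := 0)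
    (g := fun n (x : ℝ) => cf n * x ^ (n + 1) / (n + 1 : ℝ)) (g' := fun n x => cf n * x ^ n)
    (summable_geometric_of_lt_one hr0.le hr2) isOpen_Ioo isPreconnected_Ioo ?_ ?_ ?_ ?_ ?_
  · intro n y _
    have h := (((hasDerivAt_id y).pow (n + 1)).const_mul (cf n)).div_const ((n : ℝ) + 1)
    have hn : (n : ℝ) + 1 ≠ 0 := by positivity
    convert! h using 1
    simp
    field_simp
  · intro n y hy
    refine (norm_term_le y n).trans ?_
    have : |y| ≤ r := (abs_lt.2 hy).le
    gcongr
  · exact ⟨by linarith, hr0⟩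
  · simp
  · exact abs_lt.1 hr1

theorem arcsin_eq (u : ℝ) (hu : |u| < 1) :
    Real.arcsin u = ∑' n, cf n * u ^ (n + 1) / (n + 1 : ℝ) := by
  have hA : ∀ x ∈ Set.Ioo (-1 : ℝ) 1, HasDerivAt Real.arcsin (1 / √(1 - x ^ 2)) x :=
    fun x hx => Real.hasDerivAt_arcsin (by linarith [hx.1] : (-1 : ℝ) < x).ne' hx.2.ne
  have hB : ∀ x ∈ Set.Ioo (-1 : ℝ) 1, HasDerivAt
      (fun x : ℝ => ∑' n, cf n * x ^ (n + 1) / (n + 1 : ℝ)) (1 / √(1 - x ^ 2)) x :=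
    fun x hx => hasDeriv x (abs_lt.2 hx)
  refine isOpen_Ioo.eqOn_of_deriv_eq (s := Set.Ioo (-1 : ℝ) 1) (f := Real.arcsin)
    (g := fun x : ℝ => ∑' n, cf n * x ^ (n + 1) / (n + 1 : ℝ)) isPreconnected_Ioo
    (fun x hx => (hA x hx).differentiableAt.differentiableWithinAt)
    (fun x hx => (hB x hx).differentiableAt.differentiableWithinAt)
    (fun x hx => by rw [(hA x hx).deriv, (hB x hx).deriv]) (x := 0) (by simp) (by simp)
    (abs_lt.1 hu)

end BT

/-- The exponential generating function of basic triangle trees is `arcsin(u)`: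
`Σ_{n≥0} b_{2n+1} u^{2n+1}/(2n+1)! = arcsin u`. -/
theorem egf_basic_trees_arcsin (u : ℝ) (hu : |u| < 1) :
    Real.arcsin u =
      ∑' n : ℕ, (basicTreeCount (2 * n + 1) : ℝ) * u ^ (2 * n + 1)
        / (Nat.factorial (2 * n + 1)) := by
  rw [BT.arcsin_eq u hu]
  have hinj : Function.Injective (fun k : ℕ => 2 * k) := fun a b h => by simpa using h
  rw [← hinj.tsum_eq]
  · refine tsum_congr fun k => ?_
    rw [BT.basicTreeCount_eq, BT.cf, Nat.factorial_succ]
    push_cast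
    field_simp
  · intro n hn
    by_contra hne
    have : ¬ Even n := by
      rintro ⟨k, rfl⟩
      exact hne ⟨k, by simp; ring⟩
    simp [BT.cf_odd n (Nat.not_even_iff_odd.1 this)] at hn
end

section
/- Let h(u) be the exponential generating function for basic triangle trees (with respect to a fixed total order on vertex labels). Then h satisfies h''(u) = u · h'(u)³, via the bijection: a basic tree on {1,...,n+2} corresponds to a choice of k ∈ {3,...,n+2}, an ordered partition of {3,...,n+2}\{k} into three parts P₁,P₂,P₃, and basic trees on P₁∪{1}, P₂∪{2}, P₃∪{k}, with the triangle {1,2,k} adjoined. -/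
section Helpers

variable {α : Type*} [LinearOrder α] [DecidableEq α]

lemma IsBasicTree.graph {V : Finset α} {E : Finset (Finset α)} (h : IsBasicTree V E) :
    ∀ e ∈ E, e.card = 3 ∧ e ⊆ V := by
  induction h with
  | single x => simp
  | node a b c V₁ V₂ V₃ E₁ E₂ E₃ ha hb hc h12 h13 h23 hmin hmin2 t1 t2 t3 i1 i2 i3 =>
    intro e he
    simp only [Finset.mem_insert, Finset.mem_union] at he
    rcases he with rfl | (he | he) | he
    · have hab : a ≠ b := fun h => Finset.disjoint_left.1 h12 ha (h ▸ hb)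
      have hac : a ≠ c := fun h => Finset.disjoint_left.1 h13 ha (h ▸ hc)
      have hbc : b ≠ c := fun h => Finset.disjoint_left.1 h23 hb (h ▸ hc)
      refine ⟨Finset.card_eq_three.2 ⟨a, b, c, hab, hac, hbc, rfl⟩, ?_⟩
      intro x hx
      simp only [Finset.mem_insert, Finset.mem_singleton] at hx
      simp only [Finset.mem_union]
      rcases hx with rfl | rfl | rfl <;> tauto
    · exact ⟨(i1 e he).1, fun x hx => by have := (i1 e he).2 hx; simp [this]⟩
    · exact ⟨(i2 e he).1, fun x hx => by have := (i2 e he).2 hx; simp [this]⟩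
    · exact ⟨(i3 e he).1, fun x hx => by have := (i3 e he).2 hx; simp [this]⟩

lemma IsBasicTree.nonempty {V : Finset α} {E : Finset (Finset α)} (h : IsBasicTree V E) :
    V.Nonempty := by
  cases h with
  | single x => simp
  | node a b c V₁ V₂ V₃ E₁ E₂ E₃ ha => exact ⟨a, by simp [ha]⟩

lemma TriReach.mono' {E F : Finset (Finset α)} (h : E ⊆ F) {x y : α} (r : TriReach E x y) :
    TriReach F x y := by
  induction r with
  | refl => exact Relation.ReflTransGen.refl
  | tail _ hs ih =>
    obtain ⟨e, he, h1⟩ := hs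
    exact Relation.ReflTransGen.tail ih ⟨e, h he, h1⟩

lemma IsBasicTree.reach {V : Finset α} {E : Finset (Finset α)} (h : IsBasicTree V E) :
    ∀ x ∈ V, ∀ y ∈ V, TriReach E x y := by
  induction h with
  | single x =>
    intro x hx y hy
    simp only [Finset.mem_singleton] at hx hy
    subst hx; subst hy; exact Relation.ReflTransGen.refl
  | node a b c V₁ V₂ V₃ E₁ E₂ E₃ ha hb hc h12 h13 h23 hmin hmin2 t1 t2 t3 i1 i2 i3 =>
    have s1 : E₁ ⊆ insert ({a, b, c} : Finset α) (E₁ ∪ E₂ ∪ E₃) := by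
      intro e he; simp [he]
    have s2 : E₂ ⊆ insert ({a, b, c} : Finset α) (E₁ ∪ E₂ ∪ E₃) := by
      intro e he; simp [he]
    have s3 : E₃ ⊆ insert ({a, b, c} : Finset α) (E₁ ∪ E₂ ∪ E₃) := by
      intro e he; simp [he]
    have st : ∀ x ∈ ({a, b, c} : Finset α), ∀ y ∈ ({a, b, c} : Finset α),
        TriReach (insert ({a, b, c} : Finset α) (E₁ ∪ E₂ ∪ E₃)) x y := fun x hx y hy =>
      Relation.ReflTransGen.single ⟨_, Finset.mem_insert_self _ _, hx, hy⟩
    have key : ∀ x ∈ V₁ ∪ V₂ ∪ V₃,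
        TriReach (insert ({a, b, c} : Finset α) (E₁ ∪ E₂ ∪ E₃)) x a ∧
        TriReach (insert ({a, b, c} : Finset α) (E₁ ∪ E₂ ∪ E₃)) a x := by
      intro x hx
      simp only [Finset.mem_union] at hx
      rcases hx with (hx | hx) | hx
      · exact ⟨(i1 x hx a ha).mono' s1, (i1 a ha x hx).mono' s1⟩
      · exact ⟨((i2 x hx b hb).mono' s2).trans (st b (by simp) a (by simp)),
          (st a (by simp) b (by simp)).trans ((i2 b hb x hx).mono' s2)⟩
      · exact ⟨((i3 x hx c hc).mono' s3).trans (st c (by simp) a (by simp)),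
          (st a (by simp) c (by simp)).trans ((i3 c hc x hx).mono' s3)⟩
    intro x hx y hy
    exact (key x hx).1.trans (key y hy).2

lemma IsBasicTree.count {V : Finset α} {E : Finset (Finset α)} (h : IsBasicTree V E) :
    ∀ F ⊆ E, ∀ W : Finset α, W.Nonempty → W ⊆ V → (∀ e ∈ F, e ⊆ W) →
      2 * F.card + 1 ≤ W.card := by
  induction h with
  | single x =>
    intro F hF W hW _ _
    have : F = ∅ := Finset.subset_empty.1 hF
    subst this
    simpa using hW.card_pos
  | node a b c V₁ V₂ V₃ E₁ E₂ E₃ ha hb hc h12 h13 h23 hmin hmin2 t1 t2 t3 i1 i2 i3 =>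
    intro F hF W hW hWV hFW
    have aux : ∀ (U : Finset α) (D : Finset (Finset α)), (∀ e ∈ D, e.card = 3 ∧ e ⊆ U) →
        (∀ F ⊆ D, ∀ W : Finset α, W.Nonempty → W ⊆ U → (∀ e ∈ F, e ⊆ W) →
          2 * F.card + 1 ≤ W.card) →
        ((W ∩ U).Nonempty → 2 * (F ∩ D).card + 1 ≤ (W ∩ U).card) ∧
        (2 * (F ∩ D).card ≤ (W ∩ U).card) := by
      intro U D hD hi
      have h1 : (W ∩ U).Nonempty → 2 * (F ∩ D).card + 1 ≤ (W ∩ U).card := by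
        intro hne
        apply hi _ Finset.inter_subset_right _ hne Finset.inter_subset_right
        intro e he
        rw [Finset.mem_inter] at he
        exact Finset.subset_inter (hFW e he.1) (hD e he.2).2
      refine ⟨h1, ?_⟩
      by_cases hne : (W ∩ U).Nonempty
      · have := h1 hne; omega
      · have : F ∩ D = ∅ := by
          rw [Finset.eq_empty_iff_forall_notMem]
          intro e he
          rw [Finset.mem_inter] at he
          have h3 := (hD e he.2).1
          obtain ⟨x, hx⟩ : e.Nonempty := Finset.card_pos.1 (by omega)
          exact hne ⟨x, Finset.mem_inter.2 ⟨hFW e he.1 hx, (hD e he.2).2 hx⟩⟩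
        simp [this]
    obtain ⟨p1, q1⟩ := aux V₁ E₁ t1.graph i1
    obtain ⟨p2, q2⟩ := aux V₂ E₂ t2.graph i2
    obtain ⟨p3, q3⟩ := aux V₃ E₃ t3.graph i3
    have hWc : W.card = (W ∩ V₁).card + (W ∩ V₂).card + (W ∩ V₃).card := by
      rw [← Finset.card_union_of_disjoint, ← Finset.card_union_of_disjoint,
        ← Finset.inter_union_distrib_left, ← Finset.inter_union_distrib_left,
        Finset.inter_eq_left.2 hWV]
      · rw [← Finset.inter_union_distrib_left]
        exact Finset.disjoint_of_subset_left Finset.inter_subset_right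
          (Finset.disjoint_of_subset_right Finset.inter_subset_right
            (Finset.disjoint_union_left.2 ⟨h13, h23⟩))
      · exact Finset.disjoint_of_subset_left Finset.inter_subset_right
          (Finset.disjoint_of_subset_right Finset.inter_subset_right h12)
    have hu : (F ∩ (E₁ ∪ E₂ ∪ E₃)).card ≤
        (F ∩ E₁).card + (F ∩ E₂).card + (F ∩ E₃).card := by
      rw [Finset.inter_union_distrib_left, Finset.inter_union_distrib_left]
      refine (Finset.card_union_le _ _).trans ?_
      have := Finset.card_union_le (F ∩ E₁) (F ∩ E₂)
      omega
    by_cases ht : ({a, b, c} : Finset α) ∈ F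
    · have hF2 : F ⊆ insert ({a, b, c} : Finset α) (F ∩ (E₁ ∪ E₂ ∪ E₃)) := by
        intro e he
        have := hF he
        simp only [Finset.mem_insert, Finset.mem_inter] at this ⊢
        tauto
      have h1 := (Finset.card_le_card hF2).trans (Finset.card_insert_le _ _)
      have hW' := hFW _ ht
      have := p1 ⟨a, Finset.mem_inter.2 ⟨hW' (by simp), ha⟩⟩
      have := p2 ⟨b, Finset.mem_inter.2 ⟨hW' (by simp), hb⟩⟩
      have := p3 ⟨c, Finset.mem_inter.2 ⟨hW' (by simp), hc⟩⟩
      omega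
    · have hF2 : F ⊆ F ∩ (E₁ ∪ E₂ ∪ E₃) := by
        intro e he
        have := hF he
        simp only [Finset.mem_insert, Finset.mem_inter] at this ⊢
        rcases this with rfl | h
        · exact absurd he ht
        · exact ⟨he, h⟩
      have h1 := Finset.card_le_card hF2
      obtain ⟨x, hx⟩ := hW
      have hxV := hWV hx
      simp only [Finset.mem_union] at hxV
      rcases hxV with (h | h) | h
      · have := p1 ⟨x, Finset.mem_inter.2 ⟨hx, h⟩⟩; omega
      · have := p2 ⟨x, Finset.mem_inter.2 ⟨hx, h⟩⟩; omega
      · have := p3 ⟨x, Finset.mem_inter.2 ⟨hx, h⟩⟩; omega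

lemma IsBasicTree.acyclic {V : Finset α} {E : Finset (Finset α)} (h : IsBasicTree V E) :
    ¬ HasTriCycle E := by
  rintro ⟨n, e, v, hn, heE, hed, hvd, hv0, hv1, hvn, hvi⟩
  have hmem : ∀ i, i < n → v i ∈ e (i + 1) := by
    intro i hi
    rcases Nat.eq_zero_or_pos i with rfl | h0
    · exact hv1
    · exact (hvi i h0 hi).2
  have hmem' : ∀ i, i < n → v (i + 1) ∈ e (i + 1) := by
    intro i hi
    rcases Nat.lt_or_ge (i + 1) n with h1 | h1
    · exact (hvi (i + 1) (by omega) h1).1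
    · have : i + 1 = n := by omega
      rw [this]; exact hvn
  have hne : ∀ i, i < n → v i ≠ v (i + 1) := by
    intro i hi
    rcases Nat.lt_or_ge (i + 1) n with h1 | h1
    · exact hvd i (i + 1) (by omega) h1
    · have : i + 1 = n := by omega
      rw [this, hv0]
      exact (hvd 0 i (by omega) hi).symm
  let F := (Finset.range n).image fun i => e (i + 1)
  let A := (Finset.range n).image v
  let R := (Finset.range n).biUnion fun i => e (i + 1) \ {v i, v (i + 1)}
  have hFc : F.card = n := by
    rw [Finset.card_image_of_injOn, Finset.card_range]
    intro i hi j hj hij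
    simp only [Finset.coe_range, Set.mem_Iio] at hi hj
    by_contra hne
    rcases Nat.lt_or_gt_of_ne hne with h | h
    · exact hed (i + 1) (j + 1) (by omega) (by omega) (by omega) hij
    · exact hed (j + 1) (i + 1) (by omega) (by omega) (by omega) hij.symm
  have hAc : A.card ≤ n := Finset.card_image_le.trans (by simp)
  have hRc : R.card ≤ n := by
    refine (Finset.card_biUnion_le_card_mul _ _ 1 ?_).trans (by simp)
    intro i hi
    have hi := Finset.mem_range.1 hi
    rw [Finset.card_sdiff_of_subset, Finset.card_pair (hne i hi),
      (h.graph _ (heE (i + 1) (by omega) (by omega))).1]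
    intro x hx
    simp only [Finset.mem_insert, Finset.mem_singleton] at hx
    rcases hx with rfl | rfl
    · exact hmem i hi
    · exact hmem' i hi
  have hvA : ∀ i ≤ n, v i ∈ A := by
    intro i hi
    rcases Nat.lt_or_ge i n with h1 | h1
    · exact Finset.mem_image_of_mem _ (Finset.mem_range.2 h1)
    · have : i = n := by omega
      rw [this, hv0]
      exact Finset.mem_image_of_mem _ (Finset.mem_range.2 (by omega))
  have hFE : F ⊆ E := by
    intro f hf
    obtain ⟨i, hi, rfl⟩ := Finset.mem_image.1 hf
    have hi := Finset.mem_range.1 hi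
    exact heE _ (by omega) (by omega)
  have := h.count F hFE (A ∪ R) ⟨v 0, Finset.mem_union_left _ (hvA 0 (by omega))⟩ ?_ ?_
  · have h2 := Finset.card_union_le A R
    omega
  · intro x hx
    rcases Finset.mem_union.1 hx with hx | hx
    · obtain ⟨i, hi, rfl⟩ := Finset.mem_image.1 hx
      have hi := Finset.mem_range.1 hi
      exact (h.graph _ (heE (i + 1) (by omega) (by omega))).2 (hmem i hi)
    · obtain ⟨i, hi, hx⟩ := Finset.mem_biUnion.1 hx
      have hi := Finset.mem_range.1 hi
      exact (h.graph _ (heE (i + 1) (by omega) (by omega))).2 (Finset.mem_sdiff.1 hx).1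
  · intro f hf
    obtain ⟨i, hi, rfl⟩ := Finset.mem_image.1 hf
    have hi' := Finset.mem_range.1 hi
    intro x hx
    by_cases hx' : x ∈ ({v i, v (i + 1)} : Finset α)
    · apply Finset.mem_union_left
      simp only [Finset.mem_insert, Finset.mem_singleton] at hx'
      rcases hx' with rfl | rfl
      · exact hvA _ (by omega)
      · exact hvA _ (by omega)
    · exact Finset.mem_union_right _
        (Finset.mem_biUnion.2 ⟨i, hi, Finset.mem_sdiff.2 ⟨hx, hx'⟩⟩)

lemma IsBasicTree.isTriangleTree {V : Finset α} {E : Finset (Finset α)}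
    (h : IsBasicTree V E) : IsTriangleTree V E :=
  ⟨h.graph, h.acyclic, h.nonempty, h.reach⟩

lemma IsBasicTree.image {β : Type*} [LinearOrder β] [DecidableEq β]
    {V : Finset α} {E : Finset (Finset α)} (h : IsBasicTree V E) (f : α → β)
    (hf : StrictMonoOn f (V : Set α)) :
    IsBasicTree (V.image f) (E.image fun e => e.image f) := by
  induction h with
  | single x => simpa using IsBasicTree.single (f x)
  | node a b c V₁ V₂ V₃ E₁ E₂ E₃ ha hb hc h12 h13 h23 hmin hmin2 t1 t2 t3 i1 i2 i3 =>
    have u1 : V₁ ⊆ V₁ ∪ V₂ ∪ V₃ := by intro x hx; simp [hx]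
    have u2 : V₂ ⊆ V₁ ∪ V₂ ∪ V₃ := by intro x hx; simp [hx]
    have u3 : V₃ ⊆ V₁ ∪ V₂ ∪ V₃ := by intro x hx; simp [hx]
    have dis : ∀ A B : Finset α, A ⊆ V₁ ∪ V₂ ∪ V₃ → B ⊆ V₁ ∪ V₂ ∪ V₃ → Disjoint A B →
        Disjoint (A.image f) (B.image f) := by
      intro A B hA hB hAB
      rw [Finset.disjoint_left]
      intro y hy hy'
      obtain ⟨x, hx, rfl⟩ := Finset.mem_image.1 hy
      obtain ⟨z, hz, hzx⟩ := Finset.mem_image.1 hy'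
      have := hf.injOn (hB hz) (hA hx) hzx
      subst this
      exact Finset.disjoint_left.1 hAB hx hz
    have := IsBasicTree.node (f a) (f b) (f c) (V₁.image f) (V₂.image f) (V₃.image f)
      (E₁.image fun e => e.image f) (E₂.image fun e => e.image f) (E₃.image fun e => e.image f)
      (Finset.mem_image_of_mem _ ha) (Finset.mem_image_of_mem _ hb)
      (Finset.mem_image_of_mem _ hc) (dis _ _ u1 u2 h12) (dis _ _ u1 u3 h13)
      (dis _ _ u2 u3 h23) ?_ ?_
      (i1 (hf.mono (by exact_mod_cast u1))) (i2 (hf.mono (by exact_mod_cast u2)))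
      (i3 (hf.mono (by exact_mod_cast u3)))
    · simpa [Finset.image_union, Finset.image_insert] using this
    · intro y hy hya
      rw [← Finset.image_union, ← Finset.image_union] at hy
      obtain ⟨x, hx, rfl⟩ := Finset.mem_image.1 hy
      exact hf (u1 ha) hx (hmin x hx (fun h => hya (h ▸ rfl)))
    · intro y hy hya hyb
      rw [← Finset.image_union, ← Finset.image_union] at hy
      obtain ⟨x, hx, rfl⟩ := Finset.mem_image.1 hy
      exact hf (u2 hb) hx (hmin2 x hx (fun h => hya (h ▸ rfl)) (fun h => hyb (h ▸ rfl)))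

/-- In a disjoint union, the part containing `a` is determined by the edges. -/
lemma part_subset {V₁ V' W' : Finset α} {E₁ F₁ D D' : Finset (Finset α)} {a : α}
    (h1 : IsBasicTree V₁ E₁) (ha : a ∈ V₁) (ha' : a ∈ V')
    (hF : ∀ e ∈ F₁, e ⊆ V') (hD' : ∀ e ∈ D', e ⊆ W') (hdis : Disjoint V' W')
    (heq : E₁ ∪ D = F₁ ∪ D') : V₁ ⊆ V' ∧ E₁ ⊆ F₁ := by
  have hV : V₁ ⊆ V' := by
    intro x hx
    have hr := h1.reach a ha x hx
    clear hx
    induction hr with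
    | refl => exact ha'
    | tail _ hst ih =>
      obtain ⟨e, he, hy, hz⟩ := hst
      have : e ∈ F₁ ∪ D' := heq ▸ Finset.mem_union_left _ he
      rcases Finset.mem_union.1 this with h | h
      · exact hF e h hz
      · exact absurd (hD' e h hy) (Finset.disjoint_left.1 hdis ih)
  refine ⟨hV, ?_⟩
  intro e he
  have : e ∈ F₁ ∪ D' := heq ▸ Finset.mem_union_left _ he
  rcases Finset.mem_union.1 this with h | h
  · exact h
  · obtain ⟨h3, hs⟩ := h1.graph e he
    obtain ⟨x, hx⟩ : e.Nonempty := Finset.card_pos.1 (by omega)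
    exact absurd (hD' e h hx) (Finset.disjoint_left.1 hdis (hV (hs hx)))

end Helpers

open Classical in
/-- The finite set of basic trees on a finite set of naturals. -/
noncomputable def basicSet (V : Finset ℕ) : Finset (Finset (Finset ℕ)) :=
  V.powerset.powerset.filter fun E => IsBasicTree V E

lemma mem_basicSet {V : Finset ℕ} {E : Finset (Finset ℕ)} :
    E ∈ basicSet V ↔ IsBasicTree V E := by
  classical
  simp only [basicSet, Finset.mem_filter, Finset.mem_powerset, and_iff_right_iff_imp]
  intro h e he
  exact Finset.mem_powerset.2 (h.graph e he).2

lemma card_basicSet (V : Finset ℕ) : (basicSet V).card = basicTreeCount V.card := by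
  classical
  unfold basicTreeCount
  rw [← Nat.card_eq_finsetCard]
  symm
  set f : Fin V.card ↪o ℕ := V.orderEmbOfFin rfl with hf
  have hfV : (Finset.univ : Finset (Fin V.card)).image f = V := by
    apply Finset.coe_injective
    simp [hf]
  have fm : StrictMonoOn f ((Finset.univ : Finset (Fin V.card)) : Set (Fin V.card)) :=
    f.strictMono.strictMonoOn _
  refine Nat.card_eq_of_bijective
    (fun E => ⟨E.1.image fun e => e.image f, mem_basicSet.2 ?_⟩) ⟨?_, ?_⟩
  · have := E.2.2.image f fm
    rwa [hfV] at this
  · rintro ⟨E, hE⟩ ⟨E', hE'⟩ h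
    simp only [Subtype.mk.injEq] at h ⊢
    exact Finset.image_injective (Finset.image_injective f.injective) h
  · rintro ⟨E, hE⟩
    rw [mem_basicSet] at hE
    have hpos : 0 < V.card := hE.nonempty.card_pos
    have : Nonempty (Fin V.card) := ⟨⟨0, hpos⟩⟩
    let g := Function.invFun f
    have hgf : ∀ i, g (f i) = i := Function.leftInverse_invFun f.injective
    have hfg : ∀ x ∈ V, f (g x) = x := by
      intro x hx
      rw [← hfV] at hx
      obtain ⟨i, -, rfl⟩ := Finset.mem_image.1 hx
      rw [hgf]
    have gm : StrictMonoOn g (V : Set ℕ) := by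
      intro x hx y hy hxy
      rw [← f.lt_iff_lt, hfg x hx, hfg y hy]
      exact hxy
    have hb := hE.image g gm
    have hgV : V.image g = Finset.univ := by
      rw [Finset.eq_univ_iff_forall]
      intro i
      exact Finset.mem_image.2 ⟨f i, Finset.orderEmbOfFin_mem V rfl i, hgf i⟩
    rw [hgV] at hb
    refine ⟨⟨_, hb.isTriangleTree, hb⟩, ?_⟩
    simp only [Subtype.mk.injEq]
    rw [Finset.image_image]
    conv_rhs => rw [← Finset.image_id (s := E)]
    apply Finset.image_congr
    intro e he
    simp only [Function.comp, id]
    rw [Finset.image_image]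
    conv_rhs => rw [← Finset.image_id (s := e)]
    apply Finset.image_congr
    intro x hx
    exact hfg x ((hE.graph e he).2 hx)

lemma basic_rec (n : ℕ) :
      basicTreeCount (n + 2) =
        ∑ k ∈ Finset.Icc 3 (n + 2),
          ∑ P₁ ∈ ((Finset.Icc 3 (n + 2)).erase k).powerset,
            ∑ P₂ ∈ (((Finset.Icc 3 (n + 2)).erase k) \ P₁).powerset,
              basicTreeCount (P₁.card + 1) * basicTreeCount (P₂.card + 1) *
                basicTreeCount (((((Finset.Icc 3 (n + 2)).erase k) \ P₁) \ P₂).card + 1) := by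
  classical
  set S := Finset.Icc 3 (n + 2) with hS
  have hSm : ∀ x, x ∈ S ↔ 3 ≤ x ∧ x ≤ n + 2 := fun x => Finset.mem_Icc
  have h0 : basicTreeCount (n + 2) = (basicSet (Finset.Icc 1 (n + 2))).card := by
    rw [card_basicSet]; simp
  have hR : ∀ k ∈ S, ∀ P₁ ∈ (S.erase k).powerset, ∀ P₂ ∈ ((S.erase k) \ P₁).powerset,
      basicTreeCount (P₁.card + 1) * basicTreeCount (P₂.card + 1) *
                basicTreeCount ((((S.erase k) \ P₁) \ P₂).card + 1) =
      ((basicSet (insert 1 P₁) ×ˢ basicSet (insert 2 P₂)) ×ˢ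
        basicSet (insert k (((S.erase k) \ P₁) \ P₂))).card := by
    intro k hk P₁ h1 P₂ h2
    rw [Finset.mem_powerset] at h1 h2
    rw [Finset.card_product, Finset.card_product, card_basicSet, card_basicSet, card_basicSet,
      Finset.card_insert_of_notMem, Finset.card_insert_of_notMem, Finset.card_insert_of_notMem]
    · simp
    · intro h
      have := h2 h
      simp [hSm] at this
    · intro h
      have := h1 h
      simp [hSm] at this
  rw [h0]
  rw [Finset.sum_congr rfl fun k hk => Finset.sum_congr rfl fun P₁ h1 =>
    Finset.sum_congr rfl fun P₂ h2 => hR k hk P₁ h1 P₂ h2]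
  simp_rw [← Finset.card_sigma]
  symm
  have hP : ∀ k ∈ S, ∀ P₁ ⊆ S.erase k, ∀ P₂ ⊆ (S.erase k) \ P₁,
      Disjoint (insert 1 P₁) (insert 2 P₂) ∧
      Disjoint (insert 1 P₁) (insert k (((S.erase k) \ P₁) \ P₂)) ∧
      Disjoint (insert 2 P₂) (insert k (((S.erase k) \ P₁) \ P₂)) ∧
      insert 1 P₁ ∪ insert 2 P₂ ∪ insert k (((S.erase k) \ P₁) \ P₂) =
        Finset.Icc 1 (n + 2) := by
    intro k hk P₁ h1 P₂ h2
    have hk' := (hSm k).1 hk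
    have h1' : ∀ x ∈ P₁, x ≠ k ∧ 3 ≤ x ∧ x ≤ n + 2 := by
      intro x hx
      have := h1 hx
      rwa [Finset.mem_erase, hSm] at this
    have h2' : ∀ x ∈ P₂, (x ≠ k ∧ 3 ≤ x ∧ x ≤ n + 2) ∧ x ∉ P₁ := by
      intro x hx
      have := h2 hx
      rwa [Finset.mem_sdiff, Finset.mem_erase, hSm] at this
    refine ⟨?_, ?_, ?_, ?_⟩
    · rw [Finset.disjoint_left]
      intro x hx hy
      simp only [Finset.mem_insert] at hx hy
      grind
    · rw [Finset.disjoint_left]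
      intro x hx hy
      simp only [Finset.mem_insert, Finset.mem_sdiff, Finset.mem_erase, hSm] at hx hy
      grind
    · rw [Finset.disjoint_left]
      intro x hx hy
      simp only [Finset.mem_insert, Finset.mem_sdiff, Finset.mem_erase, hSm] at hx hy
      grind
    · ext x
      simp only [Finset.mem_union, Finset.mem_insert, Finset.mem_sdiff, Finset.mem_erase, hSm,
        Finset.mem_Icc]
      constructor
      · grind
      · intro h
        by_cases hx1 : x = 1
        · tauto
        by_cases hx2 : x = 2
        · tauto
        have : 3 ≤ x := by omega
        tauto
  apply Finset.card_bij (fun (x : (_ : ℕ) × (_ : Finset ℕ) × (_ : Finset ℕ) ×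
      ((Finset (Finset ℕ) × Finset (Finset ℕ)) × Finset (Finset ℕ))) _ =>
    insert ({1, 2, x.1} : Finset ℕ) (x.2.2.2.1.1 ∪ x.2.2.2.1.2 ∪ x.2.2.2.2))
  · rintro ⟨k, P₁, P₂, ⟨E₁, E₂⟩, E₃⟩ h
    simp only [Finset.mem_sigma, Finset.mem_product, Finset.mem_powerset, mem_basicSet] at h
    obtain ⟨hk, h1, h2, ⟨t1, t2⟩, t3⟩ := h
    obtain ⟨d12, d13, d23, hU⟩ := hP k hk P₁ h1 P₂ h2
    rw [mem_basicSet]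
    simp only
    have := IsBasicTree.node 1 2 k _ _ _ E₁ E₂ E₃ (Finset.mem_insert_self _ _)
      (Finset.mem_insert_self _ _) (Finset.mem_insert_self _ _) d12 d13 d23 ?_ ?_ t1 t2 t3
    · rwa [hU] at this
    · rw [hU]; intro x hx hx1
      rw [Finset.mem_Icc] at hx; omega
    · rw [hU]; intro x hx hx1 hx2
      rw [Finset.mem_Icc] at hx; omega
  · rintro ⟨k, P₁, P₂, ⟨E₁, E₂⟩, E₃⟩ h ⟨k', P₁', P₂', ⟨E₁', E₂'⟩, E₃'⟩ h' heq
    simp only [Finset.mem_sigma, Finset.mem_product, Finset.mem_powerset, mem_basicSet] at h h'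
    simp only at heq
    obtain ⟨hk, h1, h2, ⟨t1, t2⟩, t3⟩ := h
    obtain ⟨hk', h1', h2', ⟨t1', t2'⟩, t3'⟩ := h'
    obtain ⟨d12, d13, d23, hU⟩ := hP k hk P₁ h1 P₂ h2
    obtain ⟨d12', d13', d23', hU'⟩ := hP k' hk' P₁' h1' P₂' h2'
    have nt : ∀ (V₁ V₂ V₃ : Finset ℕ) (E₁ E₂ E₃ : Finset (Finset ℕ)), 1 ∈ V₁ → 2 ∈ V₂ →
        Disjoint V₁ V₂ → Disjoint V₁ V₃ → IsBasicTree V₁ E₁ → IsBasicTree V₂ E₂ →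
        IsBasicTree V₃ E₃ → ∀ e, 1 ∈ e → 2 ∈ e → e ∉ E₁ ∪ E₂ ∪ E₃ := by
      intro V₁ V₂ V₃ E₁ E₂ E₃ m1 m2 d12 d13 t1 t2 t3 e he1 he2 he
      simp only [Finset.mem_union] at he
      rcases he with (he | he) | he
      · exact Finset.disjoint_left.1 d12 ((t1.graph e he).2 he2) m2
      · exact Finset.disjoint_left.1 d12 m1 ((t2.graph e he).2 he1)
      · exact Finset.disjoint_left.1 d13 m1 ((t3.graph e he).2 he1)
    have nt1 := nt _ _ _ E₁ E₂ E₃ (Finset.mem_insert_self _ _)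
      (Finset.mem_insert_self _ _) d12 d13 t1 t2 t3
    have nt1' := nt _ _ _ E₁' E₂' E₃' (Finset.mem_insert_self _ _)
      (Finset.mem_insert_self _ _) d12' d13' t1' t2' t3'
    have hkk : k = k' := by
      have : ({1, 2, k} : Finset ℕ) ∈ insert ({1, 2, k'} : Finset ℕ) (E₁' ∪ E₂' ∪ E₃') := by
        rw [← heq]; exact Finset.mem_insert_self _ _
      rcases Finset.mem_insert.1 this with h | h
      · have hkm : k ∈ ({1, 2, k'} : Finset ℕ) := by rw [← h]; simp
        have := (hSm k).1 hk
        simp only [Finset.mem_insert, Finset.mem_singleton] at hkm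
        omega
      · exact absurd h (nt1' _ (by simp) (by simp))
    subst hkk
    have hEE : E₁ ∪ E₂ ∪ E₃ = E₁' ∪ E₂' ∪ E₃' := by
      rw [← Finset.erase_insert (nt1 {1, 2, k} (by simp) (by simp)), heq,
        Finset.erase_insert (nt1' {1, 2, k} (by simp) (by simp))]
    have gu : ∀ (V W : Finset ℕ) (E F : Finset (Finset ℕ)), IsBasicTree V E →
        IsBasicTree W F → ∀ e ∈ E ∪ F, e ⊆ V ∪ W := by
      intro V W E F hE hF e he
      rcases Finset.mem_union.1 he with h | h
      · exact (hE.graph e h).2.trans Finset.subset_union_left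
      · exact (hF.graph e h).2.trans Finset.subset_union_right
    have c1 : E₁ ∪ (E₂ ∪ E₃) = E₁' ∪ (E₂' ∪ E₃') := by
      rw [← Finset.union_assoc, hEE, Finset.union_assoc]
    have c2 : E₂ ∪ (E₁ ∪ E₃) = E₂' ∪ (E₁' ∪ E₃') := by
      rw [Finset.union_left_comm, c1, Finset.union_left_comm]
    have c3 : E₃ ∪ (E₁ ∪ E₂) = E₃' ∪ (E₁' ∪ E₂') := by
      rw [Finset.union_comm, hEE, Finset.union_comm]
    have a1 := part_subset t1 (Finset.mem_insert_self 1 P₁) (Finset.mem_insert_self 1 P₁')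
      (fun e he => (t1'.graph e he).2) (gu _ _ _ _ t2' t3')
      (Finset.disjoint_union_right.2 ⟨d12', d13'⟩) c1
    have a1' := part_subset t1' (Finset.mem_insert_self 1 P₁') (Finset.mem_insert_self 1 P₁)
      (fun e he => (t1.graph e he).2) (gu _ _ _ _ t2 t3)
      (Finset.disjoint_union_right.2 ⟨d12, d13⟩) c1.symm
    have a2 := part_subset t2 (Finset.mem_insert_self 2 P₂) (Finset.mem_insert_self 2 P₂')
      (fun e he => (t2'.graph e he).2) (gu _ _ _ _ t1' t3')
      (Finset.disjoint_union_right.2 ⟨d12'.symm, d23'⟩) c2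
    have a2' := part_subset t2' (Finset.mem_insert_self 2 P₂') (Finset.mem_insert_self 2 P₂)
      (fun e he => (t2.graph e he).2) (gu _ _ _ _ t1 t3)
      (Finset.disjoint_union_right.2 ⟨d12.symm, d23⟩) c2.symm
    have a3 := part_subset t3 (Finset.mem_insert_self k _) (Finset.mem_insert_self k _)
      (fun e he => (t3'.graph e he).2) (gu _ _ _ _ t1' t2')
      (Finset.disjoint_union_right.2 ⟨d13'.symm, d23'.symm⟩) c3
    have a3' := part_subset t3' (Finset.mem_insert_self k _) (Finset.mem_insert_self k _)
      (fun e he => (t3.graph e he).2) (gu _ _ _ _ t1 t2)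
      (Finset.disjoint_union_right.2 ⟨d13.symm, d23.symm⟩) c3.symm
    have e1 : E₁ = E₁' := a1.2.antisymm a1'.2
    have e2 : E₂ = E₂' := a2.2.antisymm a2'.2
    have e3 : E₃ = E₃' := a3.2.antisymm a3'.2
    have n1 : ∀ P ⊆ S.erase k, 1 ∉ P := by
      intro P h hh
      have := h hh
      simp [hSm] at this
    have n2 : ∀ P ⊆ S.erase k, 2 ∉ P := by
      intro P h hh
      have := h hh
      simp [hSm] at this
    have p1 : P₁ = P₁' := by
      rw [← Finset.erase_insert (n1 _ h1), a1.1.antisymm a1'.1, Finset.erase_insert (n1 _ h1')]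
    have p2 : P₂ = P₂' := by
      rw [← Finset.erase_insert (n2 _ (h2.trans Finset.sdiff_subset)), a2.1.antisymm a2'.1,
        Finset.erase_insert (n2 _ (h2'.trans Finset.sdiff_subset))]
    subst e1 e2 e3 p1 p2
    rfl
  · intro E hE
    rw [mem_basicSet] at hE
    generalize hV : Finset.Icc 1 (n + 2) = V at hE
    cases hE with
    | single x =>
      have := congrArg Finset.card hV
      simp at this
    | node a b c V₁ V₂ V₃ E₁ E₂ E₃ ha hb hc h12 h13 h23 hmin hmin2 t1 t2 t3 =>
      rw [← hV] at hmin hmin2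
      have m : ∀ x, (x ∈ V₁ ∨ x ∈ V₂ ∨ x ∈ V₃) ↔ 1 ≤ x ∧ x ≤ n + 2 := by
        intro x
        rw [← Finset.mem_Icc, hV]
        simp [or_assoc]
      have hab : a ≠ b := fun h => Finset.disjoint_left.1 h12 ha (h ▸ hb)
      have hac : a ≠ c := fun h => Finset.disjoint_left.1 h13 ha (h ▸ hc)
      have hbc : b ≠ c := fun h => Finset.disjoint_left.1 h23 hb (h ▸ hc)
      have ma := (m a).1 (by tauto)
      have mb := (m b).1 (by tauto)
      have mc := (m c).1 (by tauto)
      have ha1 : a = 1 := by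
        by_contra hne
        have := hmin 1 (by simp) (Ne.symm hne)
        omega
      subst ha1
      have hb2 : b = 2 := by
        by_contra hne
        have := hmin2 2 (by simp) (by omega) (Ne.symm hne)
        omega
      subst hb2
      have D12 := Finset.disjoint_left.1 h12
      have D13 := Finset.disjoint_left.1 h13
      have D23 := Finset.disjoint_left.1 h23
      have q1 : insert 1 (V₁.erase 1) = V₁ := Finset.insert_erase ha
      have q2 : insert 2 (V₂.erase 2) = V₂ := Finset.insert_erase hb
      have q3 : insert c ((S.erase c \ V₁.erase 1) \ V₂.erase 2) = V₃ := by
        ext x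
        have := m x
        simp only [Finset.mem_insert, Finset.mem_sdiff, Finset.mem_erase, hSm]
        grind
      refine ⟨⟨c, V₁.erase 1, V₂.erase 2, (E₁, E₂), E₃⟩, ?_, rfl⟩
      simp only [Finset.mem_sigma, Finset.mem_product, Finset.mem_powerset, mem_basicSet]
      rw [q1, q2, q3]
      refine ⟨(hSm c).2 (by omega), ?_, ?_, ⟨t1, t2⟩, t3⟩
      · intro x hx
        have := m x
        simp only [Finset.mem_erase, hSm] at hx ⊢
        grind
      · intro x hx
        have := m x
        simp only [Finset.mem_sdiff, Finset.mem_erase, hSm] at hx ⊢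
        grind

/-- Product formula for exponential generating functions. -/
lemma egf_mul (c d : ℕ → ℚ) (S : Finset ℕ) :
    ∑ P ∈ S.powerset, c P.card * d (S \ P).card =
      S.card.factorial * PowerSeries.coeff S.card
        ((PowerSeries.mk fun m => c m / m.factorial) *
          (PowerSeries.mk fun m => d m / m.factorial)) := by
  have h1 : ∑ P ∈ S.powerset, c P.card * d (S \ P).card =
      ∑ P ∈ S.powerset, (fun i => c i * d (S.card - i)) P.card := by
    apply Finset.sum_congr rfl
    intro P hP
    rw [Finset.card_sdiff_of_subset (Finset.mem_powerset.1 hP)]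
  rw [h1, Finset.sum_powerset_apply_card (fun i => c i * d (S.card - i)), PowerSeries.coeff_mul,
    Finset.Nat.sum_antidiagonal_eq_sum_range_succ_mk, Finset.mul_sum]
  apply Finset.sum_congr rfl
  intro i hi
  have hi : i ≤ S.card := by rw [Finset.mem_range] at hi; omega
  simp only [PowerSeries.coeff_mk, nsmul_eq_mul]
  rw [Nat.cast_choose ℚ hi]
  have := Nat.factorial_ne_zero i
  have := Nat.factorial_ne_zero (S.card - i)
  field_simp

lemma egf_deriv (b : ℕ → ℚ) :
    PowerSeries.derivative ℚ (PowerSeries.mk fun m => b m / m.factorial) =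
      PowerSeries.mk fun m => b (m + 1) / m.factorial := by
  ext n
  rw [PowerSeries.coeff_derivative, PowerSeries.coeff_mk, PowerSeries.coeff_mk,
    Nat.factorial_succ]
  have := Nat.factorial_ne_zero n
  have : (n : ℚ) + 1 ≠ 0 := by positivity
  push_cast
  field_simp

lemma basic_ode :
    (PowerSeries.derivative ℚ (PowerSeries.derivative ℚ (PowerSeries.mk fun m =>
        (basicTreeCount m : ℚ) / (Nat.factorial m))) =
      PowerSeries.X * (PowerSeries.derivative ℚ (PowerSeries.mk fun m =>
        (basicTreeCount m : ℚ) / (Nat.factorial m))) ^ 3) := by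
  rw [egf_deriv (fun m => (basicTreeCount m : ℚ)),
    egf_deriv (fun m => (basicTreeCount (m + 1) : ℚ))]
  set c : ℕ → ℚ := fun m => (basicTreeCount (m + 1) : ℚ) with hc
  set H : PowerSeries ℚ := PowerSeries.mk fun m => c m / m.factorial with hH
  ext n
  rw [PowerSeries.coeff_mk]
  have key : ∀ T : Finset ℕ, ∑ P₁ ∈ T.powerset, ∑ P₂ ∈ (T \ P₁).powerset,
      c P₁.card * c P₂.card * c ((T \ P₁) \ P₂).card =
      T.card.factorial * PowerSeries.coeff T.card (H ^ 3) := by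
    intro T
    have hHH : (PowerSeries.mk fun m =>
        ((m.factorial : ℚ) * PowerSeries.coeff m (H * H)) / m.factorial) = H * H := by
      ext m
      rw [PowerSeries.coeff_mk]
      have := Nat.factorial_ne_zero m
      field_simp
    have := egf_mul c (fun m => (m.factorial : ℚ) * PowerSeries.coeff m (H * H)) T
    rw [hHH, ← hH] at this
    rw [pow_succ', pow_two, ← this]
    apply Finset.sum_congr rfl
    intro P₁ _
    rw [← egf_mul c c (T \ P₁), Finset.mul_sum]
    apply Finset.sum_congr rfl
    intro P₂ _
    ring
  have hrec : c (n + 1) = ∑ k ∈ Finset.Icc 3 (n + 2),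
      (((Finset.Icc 3 (n + 2)).erase k).card.factorial : ℚ) *
        PowerSeries.coeff ((Finset.Icc 3 (n + 2)).erase k).card (H ^ 3) := by
    simp only [← key]
    simp only [hc]
    rw [basic_rec n]
    push_cast
    rfl
  have hcard : ∀ k ∈ Finset.Icc 3 (n + 2), ((Finset.Icc 3 (n + 2)).erase k).card = n - 1 := by
    intro k hk
    rw [Finset.card_erase_of_mem hk, Nat.card_Icc]
    omega
  change c (n + 1) / _ = _
  rw [hrec, Finset.sum_congr rfl fun k hk => by rw [hcard k hk], Finset.sum_const, Nat.card_Icc]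
  cases n with
  | zero => simp
  | succ m =>
    rw [PowerSeries.coeff_succ_X_mul, Nat.factorial_succ]
    have := Nat.factorial_ne_zero m
    have : (m : ℚ) + 1 ≠ 0 := by positivity
    simp only [nsmul_eq_mul]
    have h1 : m + 1 + 2 + 1 - 3 = m + 1 := by omega
    rw [h1]
    have h2 : m + 1 - 1 = m := by omega
    rw [h2]
    push_cast
    field_simp

open PowerSeries in
/-- The EGF `h` of basic triangle trees satisfies `h'' = u·(h')³`, via the bijection:
a basic tree on `{1,…,n+2}` corresponds to a choice of `k ∈ {3,…,n+2}`, an ordered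
partition of `{3,…,n+2}∖{k}` into three parts `P₁,P₂,P₃`, and basic trees on `P₁∪{1}`,
`P₂∪{2}`, `P₃∪{k}`, with the triangle `{1,2,k}` adjoined. -/
theorem basic_tree_egf_ode :
    (∀ n : ℕ,
      basicTreeCount (n + 2) =
        ∑ k ∈ Finset.Icc 3 (n + 2),
          ∑ P₁ ∈ ((Finset.Icc 3 (n + 2)).erase k).powerset,
            ∑ P₂ ∈ (((Finset.Icc 3 (n + 2)).erase k) \ P₁).powerset,
              basicTreeCount (P₁.card + 1) * basicTreeCount (P₂.card + 1) *
                basicTreeCount (((((Finset.Icc 3 (n + 2)).erase k) \ P₁) \ P₂).card + 1)) ∧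
    (d⁄dX ℚ (d⁄dX ℚ (PowerSeries.mk fun m =>
        (basicTreeCount m : ℚ) / (Nat.factorial m))) =
      PowerSeries.X * (d⁄dX ℚ (PowerSeries.mk fun m =>
        (basicTreeCount m : ℚ) / (Nat.factorial m))) ^ 3) := by
  exact ⟨basic_rec, basic_ode⟩
end

section
/- The algebra Λ_n generated over ℤ by skew-commuting degree-1 generators ω_{ijkl} (antisymmetric in ijkl, for 1 ≤ i,j,k,l ≤ n) with relations ω_{ijkl}+ω_{jklm}+ω_{klmi}+ω_{lmij}+ω_{mijk}=0, ω_{ijkl}ω_{ijkm}=0, and ω_{ijkl}ω_{lmpi}+ω_{klmp}ω_{pijk}+ω_{mpij}ω_{jklm}=0 is naturally isomorphic to the skew-commutative algebra generated by ν_{ijk} (antisymmetric in ijk, 1 ≤ i,j,k ≤ n-1) with relations ν_{ijk}ν_{ijl}=0 and ν_{ijk}ν_{klm}+ν_{jkl}ν_{lmi}+ν_{klm}ν_{mij}+ν_{lmi}ν_{ijk}+ν_{mij}ν_{jkl}=0, via ν_{ijk} ↦ ω_{ijkn}. -/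
open Finset

/-! The algebra `Λ_{m+1}`: skew-commutative algebra on degree-1 generators `ω_{ijkl}`
(antisymmetric in `ijkl`, indices in `Fin (m+1)`), with the 5-term linear relation and
the quadratic relations (om2), (om3). -/

/-- Linear relations among the generators `ω_{ijkl}`: antisymmetry, vanishing for repeated
indices, and the 5-term relation `ω_{ijkl}+ω_{jklm}+ω_{klmi}+ω_{lmij}+ω_{mijk} = 0`. -/
def omLinRels (m : ℕ) :
    Set ((Fin (m + 1) × Fin (m + 1) × Fin (m + 1) × Fin (m + 1)) →₀ ℤ) :=
  {w | ∃ i j k l, w = Finsupp.single (i, j, k, l) 1 + Finsupp.single (j, i, k, l) 1} ∪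
  {w | ∃ i j k l, w = Finsupp.single (i, j, k, l) 1 + Finsupp.single (i, k, j, l) 1} ∪
  {w | ∃ i j k l, w = Finsupp.single (i, j, k, l) 1 + Finsupp.single (i, j, l, k) 1} ∪
  {w | ∃ i j k l, ({i, j, k, l} : Finset (Fin (m + 1))).card ≠ 4 ∧
    w = Finsupp.single (i, j, k, l) 1} ∪
  {w | ∃ i j k l p, ({i, j, k, l, p} : Finset (Fin (m + 1))).card = 5 ∧
    w = Finsupp.single (i, j, k, l) 1 + Finsupp.single (j, k, l, p) 1 +
        Finsupp.single (k, l, p, i) 1 + Finsupp.single (l, p, i, j) 1 +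
        Finsupp.single (p, i, j, k) 1}

/-- The degree-1 part of `Λ_{m+1}`. -/
def OmModule (m : ℕ) :=
  ((Fin (m + 1) × Fin (m + 1) × Fin (m + 1) × Fin (m + 1)) →₀ ℤ) ⧸
    Submodule.span ℤ (omLinRels m)

noncomputable instance (m : ℕ) : AddCommGroup (OmModule m) := by unfold OmModule; infer_instance
noncomputable instance (m : ℕ) : Module ℤ (OmModule m) := by unfold OmModule; infer_instance

/-- The generator `ω_{ijkl}`, inside the exterior algebra on the degree-1 part. -/
noncomputable def omGen (m : ℕ) (i j k l : Fin (m + 1)) :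
    ExteriorAlgebra ℤ (OmModule m) :=
  ExteriorAlgebra.ι ℤ (Submodule.Quotient.mk (Finsupp.single (i, j, k, l) 1))

/-- The quadratic relations (om2) and (om3) of `Λ_{m+1}`. -/
inductive OmRel (m : ℕ) :
    ExteriorAlgebra ℤ (OmModule m) → ExteriorAlgebra ℤ (OmModule m) → Prop
  | sq (i j k l p : Fin (m + 1)) (h : ({i, j, k, l, p} : Finset (Fin (m + 1))).card = 5) :
      OmRel m (omGen m i j k l * omGen m i j k p) 0
  | tri (i j k l x y : Fin (m + 1))
      (h : ({i, j, k, l, x, y} : Finset (Fin (m + 1))).card = 6) :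
      OmRel m (omGen m i j k l * omGen m l x y i + omGen m k l x y * omGen m y i j k +
        omGen m x y i j * omGen m j k l x) 0

/-- The algebra `Λ_{m+1}`. -/
noncomputable def LambdaAlg (m : ℕ) := RingQuot (OmRel m)

noncomputable instance (m : ℕ) : Ring (LambdaAlg m) := by unfold LambdaAlg; infer_instance
noncomputable instance (m : ℕ) : Algebra ℤ (LambdaAlg m) := by unfold LambdaAlg; infer_instance

/-- The image of `ω_{ijkl}` in `Λ_{m+1}`. -/
noncomputable def omega (m : ℕ) (i j k l : Fin (m + 1)) : LambdaAlg m :=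
  RingQuot.mkAlgHom ℤ (OmRel m) (omGen m i j k l)

/-! The algebra `Λ'_{m+1}`: skew-commutative algebra on generators `ν_{ijk}`
(antisymmetric in `ijk`, indices in `Fin m`), with only quadratic relations. -/

/-- Antisymmetry and repeated-index relations for the generators `ν_{ijk}`. -/
def nuLinRels (m : ℕ) : Set ((Fin m × Fin m × Fin m) →₀ ℤ) :=
  {w | ∃ i j k, w = Finsupp.single (i, j, k) 1 + Finsupp.single (j, i, k) 1} ∪
  {w | ∃ i j k, w = Finsupp.single (i, j, k) 1 + Finsupp.single (i, k, j) 1} ∪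
  {w | ∃ i j k, ({i, j, k} : Finset (Fin m)).card ≠ 3 ∧ w = Finsupp.single (i, j, k) 1}

/-- The degree-1 part of `Λ'_{m+1}`. -/
def NuModule (m : ℕ) :=
  ((Fin m × Fin m × Fin m) →₀ ℤ) ⧸ Submodule.span ℤ (nuLinRels m)

noncomputable instance (m : ℕ) : AddCommGroup (NuModule m) := by unfold NuModule; infer_instance
noncomputable instance (m : ℕ) : Module ℤ (NuModule m) := by unfold NuModule; infer_instance

/-- The generator `ν_{ijk}`, inside the exterior algebra on the degree-1 part. -/
noncomputable def nuGen (m : ℕ) (i j k : Fin m) : ExteriorAlgebra ℤ (NuModule m) :=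
  ExteriorAlgebra.ι ℤ (Submodule.Quotient.mk (Finsupp.single (i, j, k) 1))

/-- The quadratic relations `ν_{ijk}ν_{ijl} = 0` and the 5-term cyclic quadratic relation. -/
inductive NuRel (m : ℕ) :
    ExteriorAlgebra ℤ (NuModule m) → ExteriorAlgebra ℤ (NuModule m) → Prop
  | sq (i j k l : Fin m) (h : ({i, j, k, l} : Finset (Fin m)).card = 4) :
      NuRel m (nuGen m i j k * nuGen m i j l) 0
  | five (i j k l p : Fin m) (h : ({i, j, k, l, p} : Finset (Fin m)).card = 5) :
      NuRel m (nuGen m i j k * nuGen m k l p + nuGen m j k l * nuGen m l p i +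
        nuGen m k l p * nuGen m p i j + nuGen m l p i * nuGen m i j k +
        nuGen m p i j * nuGen m j k l) 0

/-- The algebra `Λ'_{m+1}`. -/
noncomputable def LambdaAlg' (m : ℕ) := RingQuot (NuRel m)

noncomputable instance (m : ℕ) : Ring (LambdaAlg' m) := by unfold LambdaAlg'; infer_instance
noncomputable instance (m : ℕ) : Algebra ℤ (LambdaAlg' m) := by
  unfold LambdaAlg'; infer_instance

/-- The image of `ν_{ijk}` in `Λ'_{m+1}`. -/
noncomputable def nu (m : ℕ) (i j k : Fin m) : LambdaAlg' m :=
  RingQuot.mkAlgHom ℤ (NuRel m) (nuGen m i j k)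

/-! ### Abstract identities -/

section Abstract

set_option linter.unusedSimpArgs false

variable {α A : Type*} [Ring A]

/-- A family of degree one elements satisfying the relations of `Λ'` (for all indices). -/
structure NuFam (a : α → α → α → A) : Prop where
  s1 : ∀ i j k, a j i k = -a i j k
  s2 : ∀ i j k, a i k j = -a i j k
  ac : ∀ i j k i' j' k', a i j k * a i' j' k' = -(a i' j' k' * a i j k)
  sq : ∀ i j k l, a i j k * a i j l = 0

theorem NuFam.cyc {a : α → α → α → A} (h : NuFam a) (i j k : α) : a j k i = a i j k := by
  rw [h.s2, h.s1, neg_neg]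

theorem NuFam.sqAll {a : α → α → α → A} (h : NuFam a) :
    (∀ i j k l, a i j k * a i j l = 0) ∧ (∀ i j k l, a i j k * a i l j = 0) ∧
    (∀ i j k l, a i j k * a l i j = 0) ∧
    (∀ i j k l, a i k j * a i j l = 0) ∧ (∀ i j k l, a i k j * a i l j = 0) ∧
    (∀ i j k l, a i k j * a l i j = 0) ∧
    (∀ i j k l, a k i j * a i j l = 0) ∧ (∀ i j k l, a k i j * a i l j = 0) ∧
    (∀ i j k l, a k i j * a l i j = 0) := by
  have e1 : ∀ i j l, a i l j = - a i j l := fun i j l => h.s2 i j l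
  have e2 : ∀ i j l, a l i j = a i j l := fun i j l => (h.cyc l i j).symm
  refine ⟨h.sq, ?_, ?_, ?_, ?_, ?_, ?_, ?_, ?_⟩ <;> intro i j k l
  · rw [e1 i j l, mul_neg, h.sq, neg_zero]
  · rw [e2 i j l, h.sq]
  · rw [e1 i j k, neg_mul, h.sq, neg_zero]
  · rw [e1 i j k, e1 i j l, neg_mul, mul_neg, h.sq, neg_zero, neg_zero]
  · rw [e1 i j k, e2 i j l, neg_mul, h.sq, neg_zero]
  · rw [e2 i j k, h.sq]
  · rw [e2 i j k, e1 i j l, mul_neg, h.sq, neg_zero]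
  · rw [e2 i j k, e2 i j l, h.sq]

/-- The five term expression. -/
def fiveE (a : α → α → α → A) (i j k l p : α) : A :=
  a i j k * a k l p + a j k l * a l p i + a k l p * a p i j + a l p i * a i j k +
    a p i j * a j k l

/-- The boundary expression. -/
def bdE {B : Type*} [AddCommGroup B] (a : α → α → α → B) (i j k l : α) : B :=
  a i j k - a i j l + a i k l - a j k l

theorem fiveE_sorted {a : α → α → α → A} (h : NuFam a) (i j k l p : α) :
    fiveE a i j k l p = a i j k * a k l p + a j k l * a i l p - a i j p * a k l p
      - a i j k * a i l p + a i j p * a j k l := by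
  unfold fiveE
  rw [h.cyc i l p, ← h.cyc p i j, h.ac k l p i j p, h.ac i l p i j k]
  abel

theorem bd_sq {a : α → α → α → A} (h : NuFam a) (i j k l p : α) :
    bdE a i j k l * bdE a i j k p = fiveE a i j l k p - fiveE a i j p k l := by
  obtain ⟨q1, q2, q3, q4, q5, q6, q7, q8, q9⟩ := h.sqAll
  rw [fiveE_sorted h, fiveE_sorted h]
  rw [h.s1 k l p, h.s2 j k l, h.s1 k p l, h.s2 j k p, h.s2 k l p]
  simp only [bdE, mul_add, mul_sub, add_mul, sub_mul, q1, q2, q3, q4, q5, q6, q7, q8, q9,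
    mul_neg, neg_mul]
  rw [h.ac i k l i j p, h.ac j k l i j p, h.ac j k l i k p, h.ac j k p i k l]
  abel

theorem bd_tri {a : α → α → α → A} (h : NuFam a) (i j k l x y : α) :
    -(bdE a i j k l * bdE a i l x y) - bdE a k l x y * bdE a i j k y
      + bdE a i j x y * bdE a j k l x =
    fiveE a i j k l x - fiveE a i j k l y + fiveE a i j k x y - fiveE a i j l x y
      + fiveE a i k l x y - fiveE a j k l x y := by
  obtain ⟨q1, q2, q3, q4, q5, q6, q7, q8, q9⟩ := h.sqAll
  simp only [fiveE_sorted h]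
  simp only [bdE, mul_add, mul_sub, add_mul, sub_mul, q1, q2, q3, q4, q5, q6, q7, q8, q9,
    mul_neg, neg_mul]
  rw [h.ac i x y j k l, h.ac l x y i j k, h.ac k l x i j k, h.ac k l y i j k, h.ac k x y i j k,
    h.ac k l x i j y, h.ac k l y i j y, h.ac k x y i j y, h.ac l x y i j y, h.ac k l x i k y,
    h.ac l x y i k y, h.ac k l x j k y, h.ac l x y j k y, h.ac j x y j k l, h.ac i x y j k x,
    h.ac i x y j l x, h.ac i x y k l x, h.ac j x y k l x]
  abel

end Abstract

/-! ### The degree one modules -/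

section Modules

variable (m : ℕ)

/-- Degree one generator. -/
noncomputable def omM (i j k l : Fin (m + 1)) : OmModule m :=
  Submodule.Quotient.mk (Finsupp.single (i, j, k, l) 1)

/-- Degree one generator. -/
noncomputable def nuM (i j k : Fin m) : NuModule m :=
  Submodule.Quotient.mk (Finsupp.single (i, j, k) 1)

/-- The quotient map. -/
noncomputable def omMk :
    ((Fin (m + 1) × Fin (m + 1) × Fin (m + 1) × Fin (m + 1)) →₀ ℤ) →ₗ[ℤ] OmModule m :=
  (Submodule.span ℤ (omLinRels m)).mkQ

/-- The quotient map. -/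
noncomputable def nuMk : ((Fin m × Fin m × Fin m) →₀ ℤ) →ₗ[ℤ] NuModule m :=
  (Submodule.span ℤ (nuLinRels m)).mkQ

theorem omMk_single (i j k l : Fin (m + 1)) :
    omMk m (Finsupp.single (i, j, k, l) 1) = omM m i j k l := rfl

theorem nuMk_single (i j k : Fin m) :
    nuMk m (Finsupp.single (i, j, k) 1) = nuM m i j k := rfl

theorem omMk_surj : Function.Surjective (omMk m) :=
  Submodule.mkQ_surjective (Submodule.span ℤ (omLinRels m))

theorem nuMk_surj : Function.Surjective (nuMk m) :=
  Submodule.mkQ_surjective (Submodule.span ℤ (nuLinRels m))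

theorem omMk_rel {w} (h : w ∈ omLinRels m) : omMk m w = 0 :=
  (Submodule.Quotient.mk_eq_zero (Submodule.span ℤ (omLinRels m))).2 (Submodule.subset_span h)

theorem nuMk_rel {w} (h : w ∈ nuLinRels m) : nuMk m w = 0 :=
  (Submodule.Quotient.mk_eq_zero (Submodule.span ℤ (nuLinRels m))).2 (Submodule.subset_span h)

variable {m}

theorem om_lift {P : Type*} [AddCommGroup P] [Module ℤ P]
    (F : ((Fin (m + 1) × Fin (m + 1) × Fin (m + 1) × Fin (m + 1)) →₀ ℤ) →ₗ[ℤ] P)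
    (hF : ∀ w ∈ omLinRels m, F w = 0) :
    ∃ f : OmModule m →ₗ[ℤ] P, ∀ w, f (omMk m w) = F w :=
  ⟨Submodule.liftQ (Submodule.span ℤ (omLinRels m)) F (Submodule.span_le.2 hF), fun _ => rfl⟩

theorem nu_lift {P : Type*} [AddCommGroup P] [Module ℤ P]
    (F : ((Fin m × Fin m × Fin m) →₀ ℤ) →ₗ[ℤ] P)
    (hF : ∀ w ∈ nuLinRels m, F w = 0) :
    ∃ f : NuModule m →ₗ[ℤ] P, ∀ w, f (nuMk m w) = F w :=
  ⟨Submodule.liftQ (Submodule.span ℤ (nuLinRels m)) F (Submodule.span_le.2 hF), fun _ => rfl⟩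

theorem om_ext {P : Type*} [AddCommGroup P] [Module ℤ P] {f g : OmModule m →ₗ[ℤ] P}
    (h : ∀ i j k l, f (omM m i j k l) = g (omM m i j k l)) : f = g := by
  have : f.comp (omMk m) = g.comp (omMk m) := by
    refine Finsupp.lhom_ext' ?_
    rintro ⟨i, j, k, l⟩
    refine LinearMap.ext_ring ?_
    exact h i j k l
  ext x
  obtain ⟨w, rfl⟩ := omMk_surj m x
  exact LinearMap.congr_fun this w

theorem nu_ext {P : Type*} [AddCommGroup P] [Module ℤ P] {f g : NuModule m →ₗ[ℤ] P}
    (h : ∀ i j k, f (nuM m i j k) = g (nuM m i j k)) : f = g := by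
  have : f.comp (nuMk m) = g.comp (nuMk m) := by
    refine Finsupp.lhom_ext' ?_
    rintro ⟨i, j, k⟩
    refine LinearMap.ext_ring ?_
    exact h i j k
  ext x
  obtain ⟨w, rfl⟩ := nuMk_surj m x
  exact LinearMap.congr_fun this w

theorem card4 {β : Type*} [DecidableEq β] {i j k l : β} (h : ({i, j, k, l} : Finset β).card ≠ 4) :
    i = j ∨ i = k ∨ i = l ∨ j = k ∨ j = l ∨ k = l := by
  by_contra! hc
  obtain ⟨h1, h2, h3, h4, h5, h6⟩ := hc
  exact h (by simp [Finset.card_insert_of_notMem, *])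

theorem card3 {β : Type*} [DecidableEq β] {i j k : β} (h : ({i, j, k} : Finset β).card ≠ 3) :
    i = j ∨ i = k ∨ j = k := by
  by_contra! hc
  obtain ⟨h1, h2, h3⟩ := hc
  exact h (by simp [Finset.card_insert_of_notMem, *])

theorem nuM_s1 (i j k : Fin m) : nuM m j i k = -nuM m i j k := by
  have := nuMk_rel m (w := Finsupp.single (i, j, k) 1 + Finsupp.single (j, i, k) 1)
    (Or.inl (Or.inl ⟨i, j, k, rfl⟩))
  rw [map_add, nuMk_single, nuMk_single] at this
  exact (neg_eq_of_add_eq_zero_right this).symm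

theorem nuM_s2 (i j k : Fin m) : nuM m i k j = -nuM m i j k := by
  have := nuMk_rel m (w := Finsupp.single (i, j, k) 1 + Finsupp.single (i, k, j) 1)
    (Or.inl (Or.inr ⟨i, j, k, rfl⟩))
  rw [map_add, nuMk_single, nuMk_single] at this
  exact (neg_eq_of_add_eq_zero_right this).symm

theorem nuM_rep {i j k : Fin m} (h : ({i, j, k} : Finset (Fin m)).card ≠ 3) :
    nuM m i j k = 0 := by
  have := nuMk_rel m (w := Finsupp.single (i, j, k) 1) (Or.inr ⟨i, j, k, h, rfl⟩)
  rwa [nuMk_single] at this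

theorem omM_s1 (i j k l : Fin (m + 1)) : omM m j i k l = -omM m i j k l := by
  have := omMk_rel m (w := Finsupp.single (i, j, k, l) 1 + Finsupp.single (j, i, k, l) 1)
    (Or.inl (Or.inl (Or.inl (Or.inl ⟨i, j, k, l, rfl⟩))))
  rw [map_add, omMk_single, omMk_single] at this
  exact (neg_eq_of_add_eq_zero_right this).symm

theorem omM_s2 (i j k l : Fin (m + 1)) : omM m i k j l = -omM m i j k l := by
  have := omMk_rel m (w := Finsupp.single (i, j, k, l) 1 + Finsupp.single (i, k, j, l) 1)
    (Or.inl (Or.inl (Or.inl (Or.inr ⟨i, j, k, l, rfl⟩))))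
  rw [map_add, omMk_single, omMk_single] at this
  exact (neg_eq_of_add_eq_zero_right this).symm

theorem omM_s3 (i j k l : Fin (m + 1)) : omM m i j l k = -omM m i j k l := by
  have := omMk_rel m (w := Finsupp.single (i, j, k, l) 1 + Finsupp.single (i, j, l, k) 1)
    (Or.inl (Or.inl (Or.inr ⟨i, j, k, l, rfl⟩)))
  rw [map_add, omMk_single, omMk_single] at this
  exact (neg_eq_of_add_eq_zero_right this).symm

theorem omM_rep {i j k l : Fin (m + 1)}
    (h : i = j ∨ i = k ∨ i = l ∨ j = k ∨ j = l ∨ k = l) :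
    omM m i j k l = 0 := by
  have hc : ({i, j, k, l} : Finset (Fin (m + 1))).card ≠ 4 := by
    have := @Finset.card_le_three (Fin (m + 1)) 
    rcases h with rfl | rfl | rfl | rfl | rfl | rfl
    · rw [show ({i, i, k, l} : Finset (Fin (m + 1))) = {i, k, l} by ext; simp]
      have := Finset.card_le_three (a := i) (b := k) (c := l); omega
    · rw [show ({i, j, i, l} : Finset (Fin (m + 1))) = {i, j, l} by ext; simp; tauto]
      have := Finset.card_le_three (a := i) (b := j) (c := l); omega
    · rw [show ({i, j, k, i} : Finset (Fin (m + 1))) = {i, j, k} by ext; simp; tauto]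
      have := Finset.card_le_three (a := i) (b := j) (c := k); omega
    · rw [show ({i, j, j, l} : Finset (Fin (m + 1))) = {i, j, l} by ext; simp]
      have := Finset.card_le_three (a := i) (b := j) (c := l); omega
    · rw [show ({i, j, k, j} : Finset (Fin (m + 1))) = {i, j, k} by ext; simp; tauto]
      have := Finset.card_le_three (a := i) (b := j) (c := k); omega
    · rw [show ({i, j, k, k} : Finset (Fin (m + 1))) = {i, j, k} by ext; simp]
      have := Finset.card_le_three (a := i) (b := j) (c := k); omega
  have := omMk_rel m (w := Finsupp.single (i, j, k, l) 1) (Or.inl (Or.inr ⟨i, j, k, l, hc, rfl⟩))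
  rwa [omMk_single] at this

theorem omM_five {i j k l p : Fin (m + 1)}
    (h : ({i, j, k, l, p} : Finset (Fin (m + 1))).card = 5) :
    omM m i j k l + omM m j k l p + omM m k l p i + omM m l p i j + omM m p i j k = 0 := by
  have := omMk_rel m (Or.inr ⟨i, j, k, l, p, h, rfl⟩)
  simpa only [map_add, omMk_single] using this

/-- `ω_{ijkl} = ω_{ijkn} - ω_{ijln} + ω_{ikln} - ω_{jkln}`. -/
theorem omM_bd (i j k l : Fin (m + 1)) :
    omM m i j k l = bdE (fun i j k => omM m i j k (Fin.last m)) i j k l := by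
  simp only [bdE]
  set n := Fin.last m
  by_cases h4 : ({i, j, k, l} : Finset (Fin (m + 1))).card = 4
  · by_cases hn : n ∈ ({i, j, k, l} : Finset (Fin (m + 1)))
    · simp only [Finset.mem_insert, Finset.mem_singleton] at hn
      rcases hn with h | h | h | h
      · rw [← h, omM_rep (i := n) (j := j) (k := k) (l := n) (by tauto),
          omM_rep (i := n) (j := j) (k := l) (l := n) (by tauto),
          omM_rep (i := n) (j := k) (k := l) (l := n) (by tauto),
          omM_s1, omM_s2, omM_s3]
        abel
      · rw [← h, omM_rep (i := i) (j := n) (k := k) (l := n) (by tauto),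
          omM_rep (i := i) (j := n) (k := l) (l := n) (by tauto),
          omM_rep (i := n) (j := k) (k := l) (l := n) (by tauto),
          omM_s2, omM_s3]
        abel
      · rw [← h, omM_rep (i := i) (j := j) (k := n) (l := n) (by tauto),
          omM_rep (i := i) (j := n) (k := l) (l := n) (by tauto),
          omM_rep (i := j) (j := n) (k := l) (l := n) (by tauto),
          omM_s3]
        abel
      · rw [← h, omM_rep (i := i) (j := j) (k := n) (l := n) (by tauto),
          omM_rep (i := i) (j := k) (k := n) (l := n) (by tauto),
          omM_rep (i := j) (j := k) (k := n) (l := n) (by tauto)]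
        abel
    · have h5 : ({i, j, k, l, n} : Finset (Fin (m + 1))).card = 5 := by
        rw [show ({i, j, k, l, n} : Finset (Fin (m + 1))) = insert n {i, j, k, l} by
          ext; simp; tauto, Finset.card_insert_of_notMem hn, h4]
      have := omM_five h5
      rw [omM_s3 k l i n, omM_s2 k i l n, omM_s1 i k l n,
        omM_s2 l i n j, omM_s3 l i j n, omM_s1 i l j n, omM_s2 i j l n,
        omM_s1 i n j k, omM_s2 i j n k, omM_s3 i j k n] at this
      rw [← sub_eq_zero, ← this]
      abel
  · have h := card4 h4
    rw [omM_rep h]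
    rcases h with h | h | h | h | h | h
    · subst h
      rw [omM_rep (i := i) (j := i) (k := k) (by tauto), omM_rep (i := i) (j := i) (k := l) (by tauto)]
      abel
    · subst h
      rw [omM_rep (i := i) (j := j) (k := i) (by tauto), omM_rep (i := i) (j := i) (k := l) (by tauto),
        omM_s1 i j l n]
      abel
    · subst h
      rw [omM_rep (i := i) (j := j) (k := i) (by tauto), omM_rep (i := i) (j := k) (k := i) (by tauto),
        omM_s2 j i k n, omM_s1 i j k n]
      abel
    · subst h
      rw [omM_rep (i := i) (j := j) (k := j) (by tauto), omM_rep (i := j) (j := j) (k := l) (by tauto)]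
      abel
    · subst h
      rw [omM_rep (i := i) (j := j) (k := j) (by tauto), omM_rep (i := j) (j := k) (k := j) (by tauto),
        omM_s2 i j k n]
      abel
    · subst h
      rw [omM_rep (i := i) (j := k) (k := k) (by tauto), omM_rep (i := j) (j := k) (k := k) (by tauto)]
      abel

/-- Extension by zero of `ν` to indices in `Fin (m + 1)`. -/
noncomputable def nuX (i j k : Fin (m + 1)) : NuModule m :=
  if h : i ≠ Fin.last m ∧ j ≠ Fin.last m ∧ k ≠ Fin.last m then
    nuM m (i.castPred h.1) (j.castPred h.2.1) (k.castPred h.2.2) else 0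

theorem nuX_castSucc (i j k : Fin m) : nuX i.castSucc j.castSucc k.castSucc = nuM m i j k := by
  unfold nuX
  rw [dif_pos ⟨Fin.castSucc_ne_last i, Fin.castSucc_ne_last j, Fin.castSucc_ne_last k⟩]
  simp

theorem nuX_last {i j k : Fin (m + 1)} (h : i = Fin.last m ∨ j = Fin.last m ∨ k = Fin.last m) :
    nuX i j k = 0 := by
  unfold nuX
  rw [dif_neg (by tauto)]

theorem nuX_s1 (i j k : Fin (m + 1)) : nuX j i k = -nuX i j k := by
  by_cases h : i = Fin.last m ∨ j = Fin.last m ∨ k = Fin.last m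
  · rw [nuX_last h, nuX_last (by tauto), neg_zero]
  · push Not at h
    unfold nuX
    rw [dif_pos ⟨h.2.1, h.1, h.2.2⟩, dif_pos h, nuM_s1]

theorem nuX_s2 (i j k : Fin (m + 1)) : nuX i k j = -nuX i j k := by
  by_cases h : i = Fin.last m ∨ j = Fin.last m ∨ k = Fin.last m
  · rw [nuX_last h, nuX_last (by tauto), neg_zero]
  · push Not at h
    unfold nuX
    rw [dif_pos ⟨h.1, h.2.2, h.2.1⟩, dif_pos h, nuM_s2]

theorem nuX_rep {i j k : Fin (m + 1)} (he : i = j ∨ i = k ∨ j = k) : nuX i j k = 0 := by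
  by_cases h : i = Fin.last m ∨ j = Fin.last m ∨ k = Fin.last m
  · rw [nuX_last h]
  · push Not at h
    unfold nuX
    rw [dif_pos h]
    apply nuM_rep
    have := Finset.card_le_two (a := i.castPred h.1) (b := j.castPred h.2.1)
    have := Finset.card_le_two (a := i.castPred h.1) (b := k.castPred h.2.2)
    rcases he with rfl | rfl | rfl
    · simp; omega
    · rw [Finset.pair_comm, Finset.insert_comm]; simp [Finset.pair_comm] at *; omega
    · simp; omega

theorem nuX_bd_rep {i j k l : Fin (m + 1)}
    (h : i = j ∨ i = k ∨ i = l ∨ j = k ∨ j = l ∨ k = l) : bdE nuX i j k l = 0 := by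
  unfold bdE
  rcases h with h | h | h | h | h | h
  · subst h
    rw [nuX_rep (i := i) (j := i) (k := k) (by tauto), nuX_rep (i := i) (j := i) (k := l) (by tauto)]
    abel
  · subst h
    rw [nuX_rep (i := i) (j := j) (k := i) (by tauto), nuX_rep (i := i) (j := i) (k := l) (by tauto),
      nuX_s1 i j l]
    abel
  · subst h
    rw [nuX_rep (i := i) (j := j) (k := i) (by tauto), nuX_rep (i := i) (j := k) (k := i) (by tauto),
      nuX_s2 j i k, nuX_s1 i j k]
    abel
  · subst h
    rw [nuX_rep (i := i) (j := j) (k := j) (by tauto), nuX_rep (i := j) (j := j) (k := l) (by tauto)]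
    abel
  · subst h
    rw [nuX_rep (i := i) (j := j) (k := j) (by tauto), nuX_rep (i := j) (j := k) (k := j) (by tauto),
      nuX_s2 i j k]
    abel
  · subst h
    rw [nuX_rep (i := i) (j := k) (k := k) (by tauto), nuX_rep (i := j) (j := k) (k := k) (by tauto)]
    abel

theorem lc1 {R τ P : Type*} [Ring R] [AddCommGroup P] [Module R P] (F : τ → P) (t : τ) :
    Finsupp.linearCombination R F (Finsupp.single t 1) = F t := by
  rw [Finsupp.linearCombination_single, one_smul]

theorem exists_f (m : ℕ) : ∃ f : NuModule m →ₗ[ℤ] OmModule m, ∀ i j k,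
    f (nuM m i j k) = omM m i.castSucc j.castSucc k.castSucc (Fin.last m) := by
  obtain ⟨f, hf⟩ := nu_lift (m := m) (P := OmModule m)
    (Finsupp.linearCombination ℤ (fun t : Fin m × Fin m × Fin m =>
      omM m t.1.castSucc t.2.1.castSucc t.2.2.castSucc (Fin.last m))) (by
    rintro w ((⟨i, j, k, rfl⟩ | ⟨i, j, k, rfl⟩) | ⟨i, j, k, h, rfl⟩)
    · simp [omM_s1 i.castSucc j.castSucc]
    · simp [omM_s2 i.castSucc j.castSucc]
    · simp only [lc1]
      apply omM_rep
      simp only [Fin.castSucc_inj]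
      have := card3 h
      tauto)
  refine ⟨f, fun i j k => ?_⟩
  rw [← nuMk_single, hf, lc1]

theorem exists_g (m : ℕ) : ∃ g : OmModule m →ₗ[ℤ] NuModule m, ∀ i j k l,
    g (omM m i j k l) = bdE nuX i j k l := by
  obtain ⟨f, hf⟩ := om_lift (m := m) (P := NuModule m)
    (Finsupp.linearCombination ℤ
      (fun t : Fin (m + 1) × Fin (m + 1) × Fin (m + 1) × Fin (m + 1) =>
      bdE nuX t.1 t.2.1 t.2.2.1 t.2.2.2)) (by
    rintro w ((((⟨i, j, k, l, rfl⟩ | ⟨i, j, k, l, rfl⟩) | ⟨i, j, k, l, rfl⟩) | ⟨i, j, k, l, h, rfl⟩)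
      | ⟨i, j, k, l, p, h, rfl⟩)
    · simp only [map_add, lc1, bdE]
      rw [nuX_s1 i j k, nuX_s1 i j l]
      abel
    · simp only [map_add, lc1, bdE]
      rw [nuX_s2 i j k, nuX_s1 j k l]
      abel
    · simp only [map_add, lc1, bdE]
      rw [nuX_s2 i k l, nuX_s2 j k l]
      abel
    · simp only [lc1]
      exact nuX_bd_rep (card4 h)
    · simp only [map_add, lc1, bdE]
      have c : ∀ i j k : Fin (m + 1), nuX j k i = nuX i j k := fun i j k => by
        rw [nuX_s2, nuX_s1, neg_neg]
      rw [c i k l, c i k p, c i l p, c j l p, ← c l i j, ← c p i j, ← c p i k, ← c p j k]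
      abel)
  refine ⟨f, fun i j k l => ?_⟩
  rw [← omMk_single, hf, lc1]

theorem f_nuX {f : NuModule m →ₗ[ℤ] OmModule m} (hf : ∀ i j k,
    f (nuM m i j k) = omM m i.castSucc j.castSucc k.castSucc (Fin.last m))
    (i j k : Fin (m + 1)) : f (nuX i j k) = omM m i j k (Fin.last m) := by
  by_cases h : i = Fin.last m ∨ j = Fin.last m ∨ k = Fin.last m
  · rw [nuX_last h, map_zero, omM_rep (by tauto)]
  · push Not at h
    unfold nuX
    rw [dif_pos h, hf]
    simp

end Modules

/-! ### The algebras -/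

section Algebras

variable (m : ℕ)

/-- The quotient map onto `Λ`. -/
noncomputable def piO : ExteriorAlgebra ℤ (OmModule m) →ₐ[ℤ] LambdaAlg m :=
  RingQuot.mkAlgHom ℤ (OmRel m)

/-- The quotient map onto `Λ'`. -/
noncomputable def piN : ExteriorAlgebra ℤ (NuModule m) →ₐ[ℤ] LambdaAlg' m :=
  RingQuot.mkAlgHom ℤ (NuRel m)

theorem piO_surj : Function.Surjective (piO m) := RingQuot.mkAlgHom_surjective ℤ (OmRel m)

theorem piN_surj : Function.Surjective (piN m) := RingQuot.mkAlgHom_surjective ℤ (NuRel m)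

variable {m}

theorem piO_rel {x y} (h : OmRel m x y) : piO m x = piO m y := RingQuot.mkAlgHom_rel ℤ h

theorem piN_rel {x y} (h : NuRel m x y) : piN m x = piN m y := RingQuot.mkAlgHom_rel ℤ h

theorem piO_lift {B : Type*} [Ring B] [Algebra ℤ B]
    (F : ExteriorAlgebra ℤ (OmModule m) →ₐ[ℤ] B) (h : ∀ x y, OmRel m x y → F x = F y) :
    ∃ G : LambdaAlg m →ₐ[ℤ] B, ∀ x, G (piO m x) = F x :=
  ⟨RingQuot.liftAlgHom ℤ ⟨F, fun {x y} => h x y⟩,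
    fun x => RingQuot.liftAlgHom_mkAlgHom_apply ℤ F (fun {x y} => h x y) x⟩

theorem piN_lift {B : Type*} [Ring B] [Algebra ℤ B]
    (F : ExteriorAlgebra ℤ (NuModule m) →ₐ[ℤ] B) (h : ∀ x y, NuRel m x y → F x = F y) :
    ∃ G : LambdaAlg' m →ₐ[ℤ] B, ∀ x, G (piN m x) = F x :=
  ⟨RingQuot.liftAlgHom ℤ ⟨F, fun {x y} => h x y⟩,
    fun x => RingQuot.liftAlgHom_mkAlgHom_apply ℤ F (fun {x y} => h x y) x⟩

variable (m)

/-- Degree one part of `Λ`. -/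
noncomputable def oL : OmModule m →ₗ[ℤ] LambdaAlg m :=
  (piO m).toLinearMap.comp (ExteriorAlgebra.ι ℤ)

/-- Degree one part of `Λ'`. -/
noncomputable def nL : NuModule m →ₗ[ℤ] LambdaAlg' m :=
  (piN m).toLinearMap.comp (ExteriorAlgebra.ι ℤ)

variable {m}

theorem oL_sq (x : OmModule m) : oL m x * oL m x = 0 := by
  change piO m _ * piO m _ = 0
  rw [← map_mul, ExteriorAlgebra.ι_sq_zero, map_zero]

theorem nL_sq (x : NuModule m) : nL m x * nL m x = 0 := by
  change piN m _ * piN m _ = 0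
  rw [← map_mul, ExteriorAlgebra.ι_sq_zero, map_zero]

theorem oL_ac (x y : OmModule m) : oL m x * oL m y = -(oL m y * oL m x) := by
  change piO m _ * piO m _ = -(piO m _ * piO m _)
  rw [← map_mul (piO m), ← map_mul (piO m), ← map_neg (piO m),
    eq_neg_of_add_eq_zero_left (ExteriorAlgebra.ι_add_mul_swap x y)]

theorem nL_ac (x y : NuModule m) : nL m x * nL m y = -(nL m y * nL m x) := by
  change piN m _ * piN m _ = -(piN m _ * piN m _)
  rw [← map_mul (piN m), ← map_mul (piN m), ← map_neg (piN m),
    eq_neg_of_add_eq_zero_left (ExteriorAlgebra.ι_add_mul_swap x y)]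

theorem oL_relsq {i j k l p : Fin (m + 1)}
    (h : ({i, j, k, l, p} : Finset (Fin (m + 1))).card = 5) :
    oL m (omM m i j k l) * oL m (omM m i j k p) = 0 := by
  have := piO_rel (OmRel.sq i j k l p h)
  rw [map_mul, map_zero] at this
  exact this

theorem oL_reltri {i j k l x y : Fin (m + 1)}
    (h : ({i, j, k, l, x, y} : Finset (Fin (m + 1))).card = 6) :
    oL m (omM m i j k l) * oL m (omM m l x y i) + oL m (omM m k l x y) * oL m (omM m y i j k)
      + oL m (omM m x y i j) * oL m (omM m j k l x) = 0 := by
  have := piO_rel (OmRel.tri i j k l x y h)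
  rw [map_add, map_add, map_mul, map_mul, map_mul, map_zero] at this
  exact this

theorem nL_relsq {i j k l : Fin m} (h : ({i, j, k, l} : Finset (Fin m)).card = 4) :
    nL m (nuM m i j k) * nL m (nuM m i j l) = 0 := by
  have := piN_rel (NuRel.sq i j k l h)
  rw [map_mul, map_zero] at this
  exact this

theorem nL_relfive {i j k l p : Fin m} (h : ({i, j, k, l, p} : Finset (Fin m)).card = 5) :
    fiveE (fun i j k => nL m (nuM m i j k)) i j k l p = 0 := by
  have := piN_rel (NuRel.five i j k l p h)
  rw [map_add, map_add, map_add, map_add, map_mul, map_mul, map_mul, map_mul, map_mul,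
    map_zero] at this
  exact this

theorem card_cast4 (i j k l : Fin m) :
    ({i.castSucc, j.castSucc, k.castSucc, l.castSucc} : Finset (Fin (m + 1))).card =
      ({i, j, k, l} : Finset (Fin m)).card := by
  rw [← Finset.card_image_of_injective _ (Fin.castSucc_injective m)]
  simp [Finset.image_insert]

theorem card_cast5 (i j k l p : Fin m) :
    ({i.castSucc, j.castSucc, k.castSucc, l.castSucc, p.castSucc} : Finset (Fin (m + 1))).card =
      ({i, j, k, l, p} : Finset (Fin m)).card := by
  rw [← Finset.card_image_of_injective _ (Fin.castSucc_injective m)]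
  simp [Finset.image_insert]

set_option maxHeartbeats 1000000 in
theorem card6 {β : Type*} [DecidableEq β] {i j k l x y : β}
    (h : ({i, j, k, l, x, y} : Finset β).card = 6) :
    ({i, j, k, l, x} : Finset β).card = 5 ∧
    ({i, j, k, l, y} : Finset β).card = 5 ∧
    ({i, j, k, x, y} : Finset β).card = 5 ∧
    ({i, j, l, x, y} : Finset β).card = 5 ∧
    ({i, k, l, x, y} : Finset β).card = 5 ∧
    ({j, k, l, x, y} : Finset β).card = 5 := by
  have hd : ∀ (a : β) (s : Finset β), ({i, j, k, l, x, y} : Finset β) = insert a s →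
      s.card ≤ 5 → s.card = 5 := by
    intro a s hs h5
    have h1 := Finset.card_insert_le a s
    rw [← hs, h] at h1
    omega
  refine ⟨?_, ?_, ?_, ?_, ?_, ?_⟩
  · exact hd y _ (by ext; grind) Finset.card_le_five
  · exact hd x _ (by ext; grind) Finset.card_le_five
  · exact hd l _ (by ext; grind) Finset.card_le_five
  · exact hd k _ (by ext; grind) Finset.card_le_five
  · exact hd j _ (by ext; grind) Finset.card_le_five
  · exact hd i _ (by ext; grind) Finset.card_le_five

theorem nFam : NuFam (fun i j k : Fin (m + 1) => nL m (nuX i j k)) where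
  s1 i j k := by rw [nuX_s1, map_neg]
  s2 i j k := by rw [nuX_s2, map_neg]
  ac i j k i' j' k' := nL_ac _ _
  sq i j k l := by
    by_cases h1 : i = Fin.last m ∨ j = Fin.last m ∨ k = Fin.last m
    · rw [nuX_last h1, map_zero, zero_mul]
    by_cases h2 : i = Fin.last m ∨ j = Fin.last m ∨ l = Fin.last m
    · rw [nuX_last h2, map_zero, mul_zero]
    push Not at h1 h2
    obtain ⟨i, rfl⟩ := Fin.exists_castSucc_eq.2 h1.1
    obtain ⟨j, rfl⟩ := Fin.exists_castSucc_eq.2 h1.2.1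
    obtain ⟨k, rfl⟩ := Fin.exists_castSucc_eq.2 h1.2.2
    obtain ⟨l, rfl⟩ := Fin.exists_castSucc_eq.2 h2.2.2
    by_cases h4 : ({i, j, k, l} : Finset (Fin m)).card = 4
    · rw [nuX_castSucc, nuX_castSucc]
      exact nL_relsq h4
    · rcases card4 h4 with h | h | h | h | h | h
      · rw [nuX_rep (k := k.castSucc) (by simp [h]), map_zero, zero_mul]
      · rw [nuX_rep (k := k.castSucc) (by simp [h]), map_zero, zero_mul]
      · rw [nuX_rep (k := l.castSucc) (by simp [h]), map_zero, mul_zero]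
      · rw [nuX_rep (k := k.castSucc) (by simp [h]), map_zero, zero_mul]
      · rw [nuX_rep (k := l.castSucc) (by simp [h]), map_zero, mul_zero]
      · rw [h, nL_sq]

theorem nFam_five {i j k l p : Fin (m + 1)}
    (h : ({i, j, k, l, p} : Finset (Fin (m + 1))).card = 5) :
    fiveE (fun i j k : Fin (m + 1) => nL m (nuX i j k)) i j k l p = 0 := by
  by_cases hl : i ≠ Fin.last m ∧ j ≠ Fin.last m ∧ k ≠ Fin.last m ∧ l ≠ Fin.last m ∧ p ≠ Fin.last m
  · obtain ⟨h1, h2, h3, h4, h5⟩ := hl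
    obtain ⟨i, rfl⟩ := Fin.exists_castSucc_eq.2 h1
    obtain ⟨j, rfl⟩ := Fin.exists_castSucc_eq.2 h2
    obtain ⟨k, rfl⟩ := Fin.exists_castSucc_eq.2 h3
    obtain ⟨l, rfl⟩ := Fin.exists_castSucc_eq.2 h4
    obtain ⟨p, rfl⟩ := Fin.exists_castSucc_eq.2 h5
    rw [card_cast5] at h
    have := nL_relfive h
    simpa only [fiveE, nuX_castSucc] using this
  · have hz : ∀ a b c d e f : Fin (m + 1), (a = Fin.last m ∨ b = Fin.last m ∨ c = Fin.last m ∨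
        d = Fin.last m ∨ e = Fin.last m ∨ f = Fin.last m) →
        nL m (nuX a b c) * nL m (nuX d e f) = 0 := by
      intro a b c d e f h
      by_cases h1 : a = Fin.last m ∨ b = Fin.last m ∨ c = Fin.last m
      · rw [nuX_last h1, map_zero, zero_mul]
      · rw [nuX_last (i := d) (by tauto), map_zero, mul_zero]
    simp only [fiveE]
    rw [hz i j k k l p (by tauto), hz j k l l p i (by tauto), hz k l p p i j (by tauto),
      hz l p i i j k (by tauto), hz p i j j k l (by tauto)]
    simp

theorem oFam : NuFam (fun i j k : Fin (m + 1) => oL m (omM m i j k (Fin.last m))) where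
  s1 i j k := by rw [omM_s1, map_neg]
  s2 i j k := by rw [omM_s2, map_neg]
  ac i j k i' j' k' := oL_ac _ _
  sq i j k l := by
    by_cases h1 : i = j ∨ i = k ∨ i = Fin.last m ∨ j = k ∨ j = Fin.last m ∨ k = Fin.last m
    · rw [omM_rep h1, map_zero, zero_mul]
    by_cases h2 : i = j ∨ i = l ∨ i = Fin.last m ∨ j = l ∨ j = Fin.last m ∨ l = Fin.last m
    · rw [omM_rep h2, map_zero, mul_zero]
    by_cases h3 : k = l
    · rw [h3, oL_sq]
    push Not at h1 h2
    rw [omM_s3 i j (Fin.last m) k, omM_s3 i j (Fin.last m) l, map_neg, map_neg, neg_mul_neg]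
    apply oL_relsq
    obtain ⟨a1, a2, a3, a4, a5, a6⟩ := h1
    obtain ⟨b1, b2, b3, b4, b5, b6⟩ := h2
    simp [Finset.card_insert_of_notMem, *, Ne.symm a6, Ne.symm b6]

theorem oFam_bd (i j k l : Fin (m + 1)) : oL m (omM m i j k l) =
    bdE (fun i j k : Fin (m + 1) => oL m (omM m i j k (Fin.last m))) i j k l := by
  conv_lhs => rw [omM_bd]
  simp only [bdE, map_add, map_sub]

theorem omM_c4 (i j k l : Fin (m + 1)) : omM m j k l i = -omM m i j k l := by
  rw [omM_s3, omM_s2, omM_s1]; simp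

theorem oFam_five {i j k l p : Fin (m + 1)}
    (h : ({i, j, k, l, p, Fin.last m} : Finset (Fin (m + 1))).card = 6) :
    fiveE (fun i j k : Fin (m + 1) => oL m (omM m i j k (Fin.last m))) i j k l p = 0 := by
  have h1 := oL_reltri h
  have h2 := bd_tri (oFam (m := m)) i j k l p (Fin.last m)
  simp only [← oFam_bd] at h2
  rw [omM_c4 i l p (Fin.last m), ← neg_neg (omM m (Fin.last m) i j k),
    ← omM_c4 (Fin.last m) i j k, omM_c4 j p (Fin.last m) i, omM_c4 i j p (Fin.last m), neg_neg,
    map_neg, map_neg, mul_neg, mul_neg, ← sub_eq_add_neg] at h1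
  rw [h1] at h2
  have hz : ∀ i j, omM m i j (Fin.last m) (Fin.last m) = 0 := fun i j => omM_rep (by tauto)
  have hz2 : ∀ i j, omM m i (Fin.last m) j (Fin.last m) = 0 := fun i j => omM_rep (by tauto)
  have hz3 : ∀ i j, omM m (Fin.last m) i j (Fin.last m) = 0 := fun i j => omM_rep (by tauto)
  have hf : ∀ i j k l, fiveE (fun i j k : Fin (m + 1) => oL m (omM m i j k (Fin.last m)))
      i j k l (Fin.last m) = 0 := by
    intro i j k l
    simp only [fiveE, hz, hz2, hz3, map_zero, mul_zero, zero_mul, add_zero]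
  simp only [hf, sub_zero, add_zero] at h2
  exact h2.symm

end Algebras

/-- `Λ_n` is naturally isomorphic to the quadratically-presented algebra `Λ'_n` via
`ν_{ijk} ↦ ω_{ijkn}` (here `n = m + 1` and the last index plays the role of `n`). -/
theorem lambda_iso_lambda' (m : ℕ) :
    ∃ e : LambdaAlg' m ≃ₐ[ℤ] LambdaAlg m,
      ∀ i j k : Fin m, i ≠ j → i ≠ k → j ≠ k →
        e (nu m i j k) = omega m i.castSucc j.castSucc k.castSucc (Fin.last m) := by
  obtain ⟨f, hf⟩ := exists_f m
  obtain ⟨g, hg⟩ := exists_g m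
  have hgf : g.comp f = LinearMap.id := by
    apply nu_ext
    intro i j k
    rw [LinearMap.comp_apply, hf, hg, LinearMap.id_apply]
    unfold bdE
    rw [nuX_castSucc, nuX_last (k := Fin.last m) (by tauto), nuX_last (k := Fin.last m) (by tauto),
      nuX_last (k := Fin.last m) (by tauto)]
    abel
  have hfg : f.comp g = LinearMap.id := by
    apply om_ext
    intro i j k l
    rw [LinearMap.comp_apply, hg, LinearMap.id_apply]
    conv_rhs => rw [omM_bd]
    simp only [bdE, map_add, map_sub, f_nuX hf]
  have hFi : ∀ x, piO m (ExteriorAlgebra.map f (ExteriorAlgebra.ι ℤ x)) = oL m (f x) := by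
    intro x
    rw [ExteriorAlgebra.map_apply_ι]
    rfl
  have hGi : ∀ x, piN m (ExteriorAlgebra.map g (ExteriorAlgebra.ι ℤ x)) = nL m (g x) := by
    intro x
    rw [ExteriorAlgebra.map_apply_ι]
    rfl
  have hFn : ∀ i j k, piO m (ExteriorAlgebra.map f (nuGen m i j k)) =
      oL m (omM m i.castSucc j.castSucc k.castSucc (Fin.last m)) := by
    intro i j k
    rw [← hf]
    exact hFi _
  have hGn : ∀ i j k l, piN m (ExteriorAlgebra.map g (omGen m i j k l)) =
      bdE (fun i j k : Fin (m + 1) => nL m (nuX i j k)) i j k l := by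
    intro i j k l
    have h1 : nL m (bdE nuX i j k l) =
      bdE (fun i j k : Fin (m + 1) => nL m (nuX i j k)) i j k l := by
      simp only [bdE, map_add, map_sub]
    rw [← h1, ← hg]
    exact hGi _
  obtain ⟨Φ, hΦ⟩ := piN_lift ((piO m).comp (ExteriorAlgebra.map f)) (by
    intro x y h
    cases h with
    | sq i j k l h =>
      rw [AlgHom.comp_apply, AlgHom.comp_apply, map_mul, map_mul, map_zero, map_zero, hFn, hFn]
      exact oFam.sq _ _ _ _
    | five i j k l p h =>
      simp only [AlgHom.comp_apply, map_add, map_mul, map_zero, hFn]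
      refine oFam_five ?_
      rw [← card_cast5] at h
      rw [show ({i.castSucc, j.castSucc, k.castSucc, l.castSucc, p.castSucc, Fin.last m} :
        Finset (Fin (m + 1))) = insert (Fin.last m)
          {i.castSucc, j.castSucc, k.castSucc, l.castSucc, p.castSucc} by ext; simp; tauto,
        Finset.card_insert_of_notMem, h]
      simp [Fin.ext_iff, Fin.is_lt, Nat.ne_of_gt])
  obtain ⟨Ψ, hΨ⟩ := piO_lift ((piN m).comp (ExteriorAlgebra.map g)) (by
    intro x y h
    cases h with
    | sq i j k l p h =>
      rw [AlgHom.comp_apply, AlgHom.comp_apply, map_mul, map_mul, map_zero, map_zero, hGn, hGn,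
        bd_sq nFam, nFam_five, nFam_five, sub_zero]
      · rw [← h]; congr 1; ext; simp; tauto
      · rw [← h]; congr 1; ext; simp; tauto
    | tri i j k l x y h =>
      have hw : ∀ i j k l : Fin (m + 1),
          bdE (fun i j k : Fin (m + 1) => nL m (nuX i j k)) j k l i =
          -bdE (fun i j k : Fin (m + 1) => nL m (nuX i j k)) i j k l := by
        intro i j k l
        have c : ∀ i j k : Fin (m + 1), nL m (nuX j k i) = nL m (nuX i j k) := nFam.cyc
        simp only [bdE]
        rw [c i j k, c i j l, c i k l]
        abel
      obtain ⟨c1, c2, c3, c4, c5, c6⟩ := card6 h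
      have ht := bd_tri (nFam (m := m)) i j k l x y
      rw [nFam_five c1, nFam_five c2, nFam_five c3, nFam_five c4, nFam_five c5, nFam_five c6] at ht
      simp only [AlgHom.comp_apply, map_add, map_mul, map_zero, hGn]
      rw [hw i l x y, ← neg_neg (bdE _ y i j k), ← hw y i j k, hw j x y i, hw i j x y, neg_neg,
        mul_neg, mul_neg, ← sub_eq_add_neg, ht]
      simp)
  have h1 : ∀ x, Ψ (Φ x) = x := by
    intro x
    obtain ⟨x, rfl⟩ := piN_surj m x
    rw [hΦ, AlgHom.comp_apply, hΨ, AlgHom.comp_apply,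
      ← AlgHom.comp_apply (ExteriorAlgebra.map g) (ExteriorAlgebra.map f),
      ExteriorAlgebra.map_comp_map, hgf, ExteriorAlgebra.map_id, AlgHom.id_apply]
  have h2 : ∀ x, Φ (Ψ x) = x := by
    intro x
    obtain ⟨x, rfl⟩ := piO_surj m x
    rw [hΨ, AlgHom.comp_apply, hΦ, AlgHom.comp_apply,
      ← AlgHom.comp_apply (ExteriorAlgebra.map f) (ExteriorAlgebra.map g),
      ExteriorAlgebra.map_comp_map, hfg, ExteriorAlgebra.map_id, AlgHom.id_apply]
  refine ⟨AlgEquiv.ofAlgHom Φ Ψ (AlgHom.ext h2) (AlgHom.ext h1), ?_⟩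
  intro i j k _ _ _
  have : Φ (piN m (nuGen m i j k)) =
      oL m (omM m i.castSucc j.castSucc k.castSucc (Fin.last m)) := by
    rw [hΦ, AlgHom.comp_apply, hFn]
  exact this
end
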